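/- With notation as in the jumping-polynomial construction: for every σ in the value semigroup S_R = ν(R∖{0}) one has I_σ = 𝒜_σ. Consequently, the set {P_j}_{j>0} ∪ {T_i}_{i>0} of jumping polynomials is a generating sequence of ν in R. -/

import Mathlib

/-! Core combinatorial definitions for the jumping-polynomial construction. -/

namespace Jump

/-- Tuples of nonnegative integers, indexed by positive integers (index 0 unused). -/
abbrev Vec := ℕ → ℕ

/-- Pairs of tuples. -/
abbrev PVec := Vec × Vec

/-- `A` is a tuple in `ℕ₀^k` (entries indexed by `1, …, k`). -/
def Supp (k : ℕ) (A : Vec) : Prop := ∀ j : ℕ, (j = 0 ∨ k < j) → A j = 0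

/-- `A` is a tuple in `ℤ^k` (entries indexed by `1, …, k`). -/
def SuppZ (k : ℕ) (A : ℕ → ℤ) : Prop := ∀ j : ℕ, (j = 0 ∨ k < j) → A j = 0

/-- `(A, C)` is irreducible with respect to a set `T` of pairs of tuples: no member of `T`
is componentwise less than or equal to `(A, C)`. -/
def Irr (T : Set PVec) (p : PVec) : Prop := ∀ bd ∈ T, ¬ (bd.1 ≤ p.1 ∧ bd.2 ≤ p.2)

/-- The weight `A·β(k) = a₁β₁ + ⋯ + a_kβ_k` of a tuple of nonnegative integers. -/
noncomputable def wtA (β : ℕ → ℝ) (k : ℕ) (A : Vec) : ℝ :=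
  ∑ j ∈ Finset.Icc 1 k, (A j : ℝ) * β j

/-- The weight of a tuple of integers. -/
noncomputable def wtZ (β : ℕ → ℝ) (k : ℕ) (A : ℕ → ℤ) : ℝ :=
  ∑ j ∈ Finset.Icc 1 k, (A j : ℝ) * β j

/-- The weight `|(A, C)| = A·β(k) + C·γ(i)` of a pair of tuples. -/
noncomputable def wt (β γ : ℕ → ℝ) (k i : ℕ) (p : PVec) : ℝ :=
  wtA β k p.1 + wtA γ i p.2

/-- The group `G_n = β₁ℤ + ⋯ + β_nℤ` (as a subset of `ℝ`; `G_0 = {0}`). -/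
noncomputable def Gr (β : ℕ → ℝ) (n : ℕ) : Set ℝ :=
  {t | ∃ A : ℕ → ℤ, SuppZ n A ∧ t = wtZ β n A}

/-- The semigroup `S_n = β₁ℕ₀ + ⋯ + β_nℕ₀` (as a subset of `ℝ`; `S_0 = {0}`). -/
noncomputable def Sg (β : ℕ → ℝ) (n : ℕ) : Set ℝ :=
  {t | ∃ A : Vec, Supp n A ∧ t = wtA β n A}

/-- The set `G_k + H_i`. -/
noncomputable def GrH (β γ : ℕ → ℝ) (k i : ℕ) : Set ℝ :=
  {t | ∃ a ∈ Gr β k, ∃ b ∈ Gr γ i, t = a + b}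

/-- The set `G + H_i`, where `G = ⋃_{n ≤ len} G_n`. -/
noncomputable def GH (β γ : ℕ → ℝ) (len : ℕ∞) (i : ℕ) : Set ℝ :=
  {t | ∃ k : ℕ, (k : ℕ∞) ≤ len ∧ t ∈ GrH β γ k i}

/-- The set `S_k + U_i`. -/
noncomputable def SU (β γ : ℕ → ℝ) (k i : ℕ) : Set ℝ :=
  {t | ∃ a ∈ Sg β k, ∃ b ∈ Sg γ i, t = a + b}

/-- The `j`-th standard basis vector `E_j`. -/
def unitVec (j : ℕ) : Vec := fun l => if l = j then 1 else 0

/-- The set `𝒫 = {(q_jE_j, 0̄) : j ≥ 2, q_j < ∞}`. -/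
def Pset (q : ℕ → ℕ∞) : Set PVec :=
  {p | ∃ j : ℕ, 2 ≤ j ∧ ∃ t : ℕ, q j = (t : ℕ∞) ∧
        p = (fun l => t * unitVec j l, fun _ => 0)}

/-- `(A, C) ∈ ℕ₀^{m_i} × ℕ₀^i` pushes `γ_i`: `c_i > 0` and `|(A, C)| ∈ S_{m_i} + U_{i-1}`. -/
noncomputable def Push (β γ : ℕ → ℝ) (mi i : ℕ) (p : PVec) : Prop :=
  0 < p.2 i ∧ wt β γ mi i p ∈ SU β γ mi (i - 1)

/-- `(A, C)` is reduced: it pushes `γ_i` and no pair strictly below it (componentwise) does. -/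
noncomputable def Red (β γ : ℕ → ℝ) (mi i : ℕ) (p : PVec) : Prop :=
  Push β γ mi i p ∧
    ∀ p' : PVec, p'.1 ≤ p.1 → p'.2 ≤ p.2 → p' ≠ p → ¬ Push β γ mi i p'

/-- The set `𝒟_i`, built from `𝒯_i`: empty if `s_i = ∞`, otherwise the pairs in
`ℕ₀^{m_i} × ℕ₀^i` that are irreducible with respect to `𝒯_i` and reduced. -/
noncomputable def Dstep (β γ : ℕ → ℝ) (s : ℕ → ℕ∞) (m : ℕ → ℕ) (i : ℕ)
    (Ti : Set PVec) : Set PVec :=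
  if s i = ⊤ then ∅ else
    {p | Supp (m i) p.1 ∧ Supp i p.2 ∧ Irr Ti p ∧ Red β γ (m i) i p}

/-- The chain `𝒯_1 = 𝒫`, `𝒯_{i+1} = 𝒯_i ∪ 𝒟_i` (here `Tchain 0 = Tchain 1 = 𝒫`,
which is forced by the convention `s 0 = ⊤`). -/
noncomputable def Tchain (β γ : ℕ → ℝ) (q s : ℕ → ℕ∞) (m : ℕ → ℕ) : ℕ → Set PVec
  | 0 => Pset q
  | n + 1 => Tchain β γ q s m n ∪ Dstep β γ s m n (Tchain β γ q s m n)

/-- The set `𝒯 = ⋃_i 𝒯_i`. -/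
noncomputable def Tfull (β γ : ℕ → ℝ) (q s : ℕ → ℕ∞) (m : ℕ → ℕ) : Set PVec :=
  ⋃ n, Tchain β γ q s m n

/-- A tuple `A ∈ ℤ^k` is permissible: `0 ≤ a_j < q_j` for all `1 ≤ j ≤ k` with `q_j < ∞`. -/
def PermZ (q : ℕ → ℕ∞) (k : ℕ) (A : ℕ → ℤ) : Prop :=
  ∀ j : ℕ, 1 ≤ j → j ≤ k → ∀ t : ℕ, q j = (t : ℕ∞) → 0 ≤ A j ∧ A j < (t : ℤ)

/-- A tuple `A ∈ ℕ₀^k` is permissible: `a_j < q_j` for all `1 ≤ j ≤ k` with `q_j < ∞`. -/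
def PermN (q : ℕ → ℕ∞) (k : ℕ) (A : Vec) : Prop :=
  ∀ j : ℕ, 1 ≤ j → j ≤ k → ∀ t : ℕ, q j = (t : ℕ∞) → A j < t

/-- The abstract combinatorial setup of the jumping-polynomial construction:
a finite (of length `len`) or infinite (`len = ⊤`) sequence `β` of positive reals,
a sequence `γ` of nonnegative reals, and the derived data `q_j`, `s_i`, `m_i`
defined by their minimality properties. -/
structure Setup where
  /-- the length of the `β`-sequence (possibly `∞`) -/
  len : ℕ∞
  β : ℕ → ℝ
  γ : ℕ → ℝ
  q : ℕ → ℕ∞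
  s : ℕ → ℕ∞
  m : ℕ → ℕ
  hlen : 2 ≤ len
  hβ : ∀ j : ℕ, 1 ≤ j → (j : ℕ∞) ≤ len → 0 < β j
  hγ : ∀ i : ℕ, 1 ≤ i → 0 ≤ γ i
  hq1 : q 1 = ⊤
  hqtop : ∀ j : ℕ, len < (j : ℕ∞) → q j = ⊤
  hq : ∀ j : ℕ, 2 ≤ j → (j : ℕ∞) ≤ len →
    q j = sInf {x : ℕ∞ | ∃ t : ℕ, x = (t : ℕ∞) ∧ 0 < t ∧ (t : ℝ) * β j ∈ Gr β (j - 1)}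
  /-- if `q_j = ∞` then `β_j` is the last term of the `β`-sequence, and conversely -/
  hlast : ∀ j : ℕ, 2 ≤ j → (j : ℕ∞) ≤ len → (q j = ⊤ ↔ len = (j : ℕ∞))
  /-- `β_{j+1} > q_jβ_j` whenever `q_j < ∞` -/
  hgrow : ∀ j : ℕ, 2 ≤ j → (j : ℕ∞) ≤ len → ∀ t : ℕ, q j = (t : ℕ∞) →
    (t : ℝ) * β j < β (j + 1)
  hs0 : s 0 = ⊤
  hs : ∀ i : ℕ, 1 ≤ i →
    s i = sInf {x : ℕ∞ | ∃ t : ℕ, x = (t : ℕ∞) ∧ 0 < t ∧ (t : ℝ) * γ i ∈ GH β γ len (i - 1)}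
  hm0 : m 0 = 1
  hmtop : ∀ i : ℕ, 1 ≤ i → s i = ⊤ → m i = m (i - 1)
  hmfin : ∀ i : ℕ, 1 ≤ i → ∀ t : ℕ, s i = (t : ℕ∞) →
    m i = max (m (i - 1))
      (sInf {j : ℕ | 1 ≤ j ∧ (j : ℕ∞) ≤ len ∧ (t : ℝ) * γ i ∈ GrH β γ j (i - 1)})
  hmlen : ∀ i : ℕ, 1 ≤ m i ∧ ((m i : ℕ) : ℕ∞) ≤ len

end Jump

namespace Jump

open Classical in
/-- The added set at step `i` of the `𝒯`-chain in the full construction: `{(0̄, E_i)}` if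
`T_i = 0`, and `𝒟_i` otherwise. -/
noncomputable def Astep (β γ : ℕ → ℝ) (s : ℕ → ℕ∞) (m : ℕ → ℕ) (Tz : ℕ → Prop)
    (i : ℕ) (Ti : Set PVec) : Set PVec :=
  if i = 0 then ∅
  else if Tz i then {(fun _ => 0, unitVec i)}
  else Dstep β γ s m i Ti

open Classical in
/-- The set `𝒟_i` in the full construction: empty when `T_i = 0`. -/
noncomputable def DsetR (β γ : ℕ → ℝ) (s : ℕ → ℕ∞) (m : ℕ → ℕ) (Tz : ℕ → Prop)
    (i : ℕ) (Ti : Set PVec) : Set PVec :=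
  if Tz i then ∅ else Dstep β γ s m i Ti

/-- The chain `𝒯_1 = 𝒫`, `𝒯_{i+1} = 𝒯_i ∪ 𝒟_i` (resp. `𝒯_{i+1} = 𝒯_i ∪ {(0̄, E_i)}` when
`T_i = 0`) of the full construction. -/
noncomputable def TchainR (β γ : ℕ → ℝ) (q s : ℕ → ℕ∞) (m : ℕ → ℕ) (Tz : ℕ → Prop) :
    ℕ → Set PVec
  | 0 => Pset q
  | n + 1 => TchainR β γ q s m Tz n ∪ Astep β γ s m Tz n (TchainR β γ q s m Tz n)

/-- The set `𝒯 = ⋃_i 𝒯_i` of the full construction. -/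
noncomputable def TfullR (β γ : ℕ → ℝ) (q s : ℕ → ℕ∞) (m : ℕ → ℕ) (Tz : ℕ → Prop) :
    Set PVec :=
  ⋃ n, TchainR β γ q s m Tz n

/-- The full setting of the paper: `𝐤` a field, `K` an algebraic function field of
transcendence degree 3 over `𝐤`, `ν` a rank 1 `𝐤`-valuation of `K` (with real values,
written additively) with residue field `𝐤`, and `(R, m_R)` a 3-dimensional regular local
subring of `K` with quotient field `K`, dominated by `ν`, with regular parameters
`x, y, z` of increasing value; together with the sequences `{P_j}`, `{T_i}` of jumping
polynomials produced by the algorithm of Section 3, and all their associated data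
(`β`, `γ`, `q`, `s`, `m`, `δ`, `𝒫`, `𝒟_i`, `𝒯_i`). -/
structure RSetup (K : Type) [Field K] where
  /-- the coefficient field `𝐤`, as a subfield of `K` -/
  kk : Subfield K
  /-- the valuation, written additively -/
  ν : K → ℝ
  /-- the regular local ring `R` -/
  R : Subring K
  x : K
  y : K
  z : K
  /-- the length of the sequence `{P_j}` (possibly `∞`) -/
  len : ℕ∞
  P : ℕ → K
  T : ℕ → K
  β : ℕ → ℝ
  γ : ℕ → ℝ
  q : ℕ → ℕ∞
  s : ℕ → ℕ∞
  m : ℕ → ℕ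
  δ : ℕ → ℕ
  -- `K` is an algebraic function field of transcendence degree 3 over `𝐤`:
  hfg : ∃ t : Finset K, Subfield.closure ((kk : Set K) ∪ (t : Set K)) = ⊤
  htrdeg : ∃ sfn : Fin 3 → K,
    Function.Injective (MvPolynomial.eval₂Hom kk.subtype sfn) ∧
    ∀ a : K, ∃ p : Polynomial K, p ≠ 0 ∧
      (∀ n : ℕ, p.coeff n ∈ Subfield.closure ((kk : Set K) ∪ Set.range sfn)) ∧
      Polynomial.eval a p = 0
  -- `ν` is a rank 1 `𝐤`-valuation with residue field `𝐤`:
  hmul : ∀ f g : K, f ≠ 0 → g ≠ 0 → ν (f * g) = ν f + ν g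
  hadd : ∀ f g : K, f ≠ 0 → g ≠ 0 → f + g ≠ 0 → min (ν f) (ν g) ≤ ν (f + g)
  htriv : ∀ c : K, c ∈ kk → c ≠ 0 → ν c = 0
  hres : ∀ f : K, f ≠ 0 → 0 ≤ ν f → ∃ c ∈ kk, f - c = 0 ∨ 0 < ν (f - c)
  -- `R` is a local subring of `K` containing `𝐤`, with quotient field `K`,
  -- dominated by `ν`:
  hkR : (kk : Set K) ⊆ R
  hfrac : ∀ f : K, ∃ a b : K, a ∈ R ∧ b ∈ R ∧ b ≠ 0 ∧ f = a / b
  hdom : ∀ f ∈ R, f ≠ 0 → 0 ≤ ν f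
  hloc : ∀ f ∈ R, f ≠ 0 → ν f = 0 → f⁻¹ ∈ R
  -- `R` is regular of dimension 3 with regular parameters `x, y, z`, and
  -- `0 < ν(x) ≤ ν(y) ≤ ν(z)`:
  hx : x ∈ R
  hy : y ∈ R
  hz : z ∈ R
  hxne : x ≠ 0
  hyne : y ≠ 0
  hzne : z ≠ 0
  hνx : 0 < ν x
  hνxy : ν x ≤ ν y
  hνyz : ν y ≤ ν z
  hdim : ringKrullDim R = ((3 : ℕ) : WithBot ℕ∞)
  hparam : ∀ (f : K) (hf : f ∈ R), f ≠ 0 → 0 < ν f →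
    (⟨f, hf⟩ : R) ∈ Ideal.span ({⟨x, hx⟩, ⟨y, hy⟩, ⟨z, hz⟩} : Set R)
  -- the sequence `{P_j}` of jumping polynomials and its values `β_j = ν(P_j)`:
  hlen : 2 ≤ len
  hPmem : ∀ j : ℕ, 1 ≤ j → (j : ℕ∞) ≤ len → P j ∈ R
  hPne : ∀ j : ℕ, 1 ≤ j → (j : ℕ∞) ≤ len → P j ≠ 0
  hP1 : P 1 = x
  hP2 : P 2 = y
  hβ : ∀ j : ℕ, 1 ≤ j → (j : ℕ∞) ≤ len → β j = ν (P j)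
  hq1 : q 1 = ⊤
  hqtop : ∀ j : ℕ, len < (j : ℕ∞) → q j = ⊤
  hq : ∀ j : ℕ, 2 ≤ j → (j : ℕ∞) ≤ len →
    q j = sInf {u : ℕ∞ | ∃ t : ℕ, u = (t : ℕ∞) ∧ 0 < t ∧ (t : ℝ) * β j ∈ Gr β (j - 1)}
  /-- the sequence `{P_j}` ends at `P_j` exactly when `q_j = ∞` -/
  hlast : ∀ j : ℕ, 2 ≤ j → (j : ℕ∞) ≤ len → (q j = ⊤ ↔ len = (j : ℕ∞))
  /-- the recursion `P_{j+1} = P_j^{q_j} − λ_jP^{L(j)}`, where `(L(j), 0̄)` is irreducible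
  with respect to `𝒫_j` with `q_jβ_j = L(j)·β(j−1)` and `λ_j ∈ 𝐤∖{0}` is the residue of
  `P_j^{q_j}/P^{L(j)}` (so that `ν(P_{j+1}) > q_jβ_j`) -/
  hPrec : ∀ j : ℕ, 2 ≤ j → (j : ℕ∞) ≤ len → ∀ t : ℕ, q j = (t : ℕ∞) →
    ∃ (lam : K) (LL : Vec), lam ∈ kk ∧ lam ≠ 0 ∧ Supp (j - 1) LL ∧
      (∀ l : ℕ, 2 ≤ l → l ≤ j - 1 → ∀ u : ℕ, q l = (u : ℕ∞) → LL l < u) ∧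
      (t : ℝ) * β j = wtA β (j - 1) LL ∧
      P (j + 1) = P j ^ t - lam * ∏ l ∈ Finset.Icc 1 (j - 1), P l ^ LL l ∧
      (t : ℝ) * β j < ν (P (j + 1))
  -- the sequence `{T_i}` of jumping polynomials and its values `γ_i`:
  hTmem : ∀ i : ℕ, 1 ≤ i → T i ∈ R
  hT1 : T 1 = z
  hγ : ∀ i : ℕ, 1 ≤ i → (T i = 0 → γ i = 0) ∧ (T i ≠ 0 → γ i = ν (T i))
  hs0 : s 0 = ⊤
  hsz : ∀ i : ℕ, 1 ≤ i → T i = 0 → s i = 1 ∧ m i = m (i - 1)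
  hs : ∀ i : ℕ, 1 ≤ i → T i ≠ 0 →
    s i = sInf {u : ℕ∞ | ∃ t : ℕ, u = (t : ℕ∞) ∧ 0 < t ∧ (t : ℝ) * γ i ∈ GH β γ len (i - 1)}
  hm0 : m 0 = 1
  hmtop : ∀ i : ℕ, 1 ≤ i → T i ≠ 0 → s i = ⊤ → m i = m (i - 1)
  hmfin : ∀ i : ℕ, 1 ≤ i → T i ≠ 0 → ∀ t : ℕ, s i = (t : ℕ∞) →
    m i = max (m (i - 1))
      (sInf {j : ℕ | 1 ≤ j ∧ (j : ℕ∞) ≤ len ∧ (t : ℝ) * γ i ∈ GrH β γ j (i - 1)})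
  hmlen : ∀ i : ℕ, 1 ≤ m i ∧ ((m i : ℕ) : ℕ∞) ≤ len
  -- `δ_i = #𝒟_i` (with `δ_0 = 1`):
  hδ0 : δ 0 = 1
  hδ : ∀ i : ℕ, 1 ≤ i →
    (DsetR β γ s m (fun n => T n = 0) i
        (TchainR β γ q s m (fun n => T n = 0) i)).Finite ∧
    δ i = (DsetR β γ s m (fun n => T n = 0) i
        (TchainR β γ q s m (fun n => T n = 0) i)).ncard
  /-- the recursion for the `T`-sequence: for each `i` with `T_i ≠ 0` and `s_i < ∞`, the
  elements of `𝒟_i`, enumerated as `(A,C)_1, …, (A,C)_{δ_i}` in increasing order of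
  `|(A,C)|`, give `T_{(Σ_{j=0}^{i-1}δ_j)+k} = T_{AC} = P^AT^C − μ_{AC}P^{L(AC)}T^{N(AC)}`,
  where `(L(AC), N(AC)) ∈ ℕ₀^{m_i} × ℕ₀^{i-1}` is irreducible with respect to `𝒯_i` with
  `|(L(AC), N(AC))| = |(A,C)|` and `μ_{AC} ∈ 𝐤∖{0}` is the residue of
  `P^AT^C/(P^{L(AC)}T^{N(AC)})` (so that `ν(T_{AC}) > |(A,C)|` unless `T_{AC} = 0`) -/
  hTrec : ∀ i : ℕ, 1 ≤ i → T i ≠ 0 → s i ≠ ⊤ →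
    ∃ e : ↥(DsetR β γ s m (fun n => T n = 0) i
        (TchainR β γ q s m (fun n => T n = 0) i)) ≃ Fin (δ i),
      (∀ p p', ((e p : Fin (δ i)) : ℕ) ≤ ((e p' : Fin (δ i)) : ℕ) →
        wt β γ (m i) i p.1 ≤ wt β γ (m i) i p'.1) ∧
      ∀ p, ∃ (LL NN : Vec) (mu : K),
        Supp (m i) LL ∧ Supp (i - 1) NN ∧
        Irr (TchainR β γ q s m (fun n => T n = 0) i) (LL, NN) ∧
        wt β γ (m i) (i - 1) (LL, NN) = wt β γ (m i) i p.1 ∧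
        mu ∈ kk ∧ mu ≠ 0 ∧
        T ((∑ j ∈ Finset.range i, δ j) + ((e p : Fin (δ i)) : ℕ) + 1) =
          (∏ l ∈ Finset.Icc 1 (m i), P l ^ (p : PVec).1 l) *
            (∏ l ∈ Finset.Icc 1 i, T l ^ (p : PVec).2 l) -
          mu * (∏ l ∈ Finset.Icc 1 (m i), P l ^ LL l) *
            (∏ l ∈ Finset.Icc 1 (i - 1), T l ^ NN l) ∧
        (T ((∑ j ∈ Finset.range i, δ j) + ((e p : Fin (δ i)) : ℕ) + 1) = 0 ∨
          wt β γ (m i) i p.1 <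
            ν (T ((∑ j ∈ Finset.range i, δ j) + ((e p : Fin (δ i)) : ℕ) + 1)))

namespace RSetup

variable {K : Type} [Field K] (d : RSetup K)

/-- The monomial `P^A = ∏_{l=1}^{k} P_l^{a_l}`. -/
noncomputable def Pm (k : ℕ) (A : Vec) : K := ∏ l ∈ Finset.Icc 1 k, d.P l ^ A l

/-- The monomial `T^C = ∏_{l=1}^{i} T_l^{c_l}`. -/
noncomputable def Tm (i : ℕ) (C : Vec) : K := ∏ l ∈ Finset.Icc 1 i, d.T l ^ C l

/-- The set `𝒯 = ⋃_i 𝒯_i` of the construction. -/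
noncomputable def TF : Set PVec :=
  TfullR d.β d.γ d.q d.s d.m (fun n => d.T n = 0)

/-- The value semigroup `S_R = ν(R∖{0})`. -/
def SR : Set ℝ := {t : ℝ | ∃ f : K, f ∈ d.R ∧ f ≠ 0 ∧ d.ν f = t}

/-- The valuation ideal `I_σ = {f ∈ R : ν(f) ≥ σ}` (as a subset of `K`). -/
def Iv (σ : ℝ) : Set K := {f : K | f ∈ d.R ∧ (f = 0 ∨ σ ≤ d.ν f)}

/-- The ideal `𝒜_σ` of `R` generated by the monomials `P^AT^C` with `|(A, C)| ≥ σ`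
(as a subset of `K`). -/
noncomputable def Av (σ : ℝ) : Set K :=
  {f : K | ∃ (M : ℕ) (g : Fin M → K) (kb ib : Fin M → ℕ) (A C : Fin M → Vec),
    (∀ e, g e ∈ d.R) ∧ (∀ e, ((kb e : ℕ) : ℕ∞) ≤ d.len) ∧
    (∀ e, Supp (kb e) (A e)) ∧ (∀ e, Supp (ib e) (C e)) ∧
    (∀ e, σ ≤ wt d.β d.γ (kb e) (ib e) (A e, C e)) ∧
    f = ∑ e, g e * (d.Pm (kb e) (A e) * d.Tm (ib e) (C e))}

/-- The ideal `𝒜⁺_σ` of `R` generated by the monomials `P^AT^C` with `|(A, C)| > σ`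
(as a subset of `K`). -/
noncomputable def Avplus (σ : ℝ) : Set K :=
  {f : K | ∃ (M : ℕ) (g : Fin M → K) (kb ib : Fin M → ℕ) (A C : Fin M → Vec),
    (∀ e, g e ∈ d.R) ∧ (∀ e, ((kb e : ℕ) : ℕ∞) ≤ d.len) ∧
    (∀ e, Supp (kb e) (A e)) ∧ (∀ e, Supp (ib e) (C e)) ∧
    (∀ e, σ < wt d.β d.γ (kb e) (ib e) (A e, C e)) ∧
    f = ∑ e, g e * (d.Pm (kb e) (A e) * d.Tm (ib e) (C e))}

end RSetup

end Jump

namespace Jump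

/-- The group `G_n` as an additive subgroup of `ℝ`. -/
noncomputable def grSubgroup (β : ℕ → ℝ) (n : ℕ) : AddSubgroup ℝ where
  carrier := Gr β n
  zero_mem' := ⟨0, fun _ _ => rfl, by simp [wtZ]⟩
  add_mem' := by
    rintro _ _ ⟨A, hA, rfl⟩ ⟨B, hB, rfl⟩
    refine ⟨A + B, fun j hj => by simp [hA j hj, hB j hj], ?_⟩
    simp [wtZ, add_mul, Finset.sum_add_distrib]
  neg_mem' := by
    rintro _ ⟨A, hA, rfl⟩
    refine ⟨-A, fun j hj => by simp [hA j hj], ?_⟩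
    simp [wtZ]

theorem sum_mem_grSubgroup (β : ℕ → ℝ) (n : ℕ) (A : ℕ → ℤ) :
    ∑ l ∈ Finset.Icc 1 n, (A l : ℝ) * β l ∈ grSubgroup β n := by
  refine ⟨fun l => if l ∈ Finset.Icc 1 n then A l else 0, ?_, ?_⟩
  · intro j hj
    have : j ∉ Finset.Icc 1 n := by simp; omega
    simp only [this, if_false]
  · refine Finset.sum_congr rfl fun l hl => ?_
    simp only [hl, if_true]

theorem grSubgroup_mono (β : ℕ → ℝ) : Monotone (grSubgroup β) := by
  rintro n n' h _ ⟨A, hA, rfl⟩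
  have : wtZ β n A = ∑ l ∈ Finset.Icc 1 n', (A l : ℝ) * β l := by
    refine Finset.sum_subset (Finset.Icc_subset_Icc_right h) fun l hl hl' => ?_
    rw [hA l (by simp at hl hl'; omega)]
    simp
  rw [this]
  exact sum_mem_grSubgroup β n' A

theorem grSubgroup_succ {β : ℕ → ℝ} {n : ℕ} {t : ℝ} (ht : t ∈ grSubgroup β (n + 1)) :
    ∃ a : ℤ, t - a * β (n + 1) ∈ grSubgroup β n := by
  obtain ⟨A, -, rfl⟩ := ht
  refine ⟨A (n + 1), ?_⟩
  rw [wtZ, Finset.sum_Icc_succ_top (by omega), add_sub_cancel_right]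
  exact sum_mem_grSubgroup β n A

theorem mem_GrH {β γ : ℕ → ℝ} {k i : ℕ} {t : ℝ} :
    t ∈ GrH β γ k i ↔ t ∈ grSubgroup β k ⊔ grSubgroup γ i := by
  rw [AddSubgroup.mem_sup]
  constructor
  · rintro ⟨a, ha, b, hb, rfl⟩
    exact ⟨a, ha, b, hb, rfl⟩
  · rintro ⟨a, ha, b, hb, rfl⟩
    exact ⟨a, ha, b, hb, rfl⟩

/-- The group `G + H_i` as an additive subgroup of `ℝ`. -/
noncomputable def ghSubgroup (β γ : ℕ → ℝ) (len : ℕ∞) (i : ℕ) : AddSubgroup ℝ where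
  carrier := GH β γ len i
  zero_mem' := ⟨0, by simp, mem_GrH.2 (zero_mem _)⟩
  add_mem' := by
    rintro a b ⟨k, hk, ha⟩ ⟨l, hl, hb⟩
    refine ⟨max k l, by rcases max_choice k l with h | h <;> rw [h] <;> assumption, ?_⟩
    rw [mem_GrH] at *
    exact add_mem (sup_le_sup_right (grSubgroup_mono β (le_max_left k l)) _ ha)
      (sup_le_sup_right (grSubgroup_mono β (le_max_right k l)) _ hb)
  neg_mem' := by
    rintro a ⟨k, hk, ha⟩
    exact ⟨k, hk, mem_GrH.2 (neg_mem (mem_GrH.1 ha))⟩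

theorem mem_ghSubgroup {β γ : ℕ → ℝ} {len : ℕ∞} {i k : ℕ} {t : ℝ} (hk : (k : ℕ∞) ≤ len)
    (ht : t ∈ grSubgroup β k ⊔ grSubgroup γ i) : t ∈ ghSubgroup β γ len i :=
  ⟨k, hk, mem_GrH.2 ht⟩

/-- The least positive multiplier carrying `b` into a subgroup divides every such multiplier. -/
theorem exists_eq_natCast_of_zmul_mem (G : AddSubgroup ℝ) (b : ℝ) {u : ℕ∞}
    (hu : u = sInf {x : ℕ∞ | ∃ t : ℕ, x = (t : ℕ∞) ∧ 0 < t ∧ (t : ℝ) * b ∈ G})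
    {z : ℤ} (hz : z ≠ 0) (hzb : (z : ℝ) * b ∈ G) :
    ∃ t : ℕ, u = t ∧ 0 < t ∧ (t : ℝ) * b ∈ G ∧ (t : ℤ) ∣ z := by
  have hne : {x : ℕ∞ | ∃ t : ℕ, x = (t : ℕ∞) ∧ 0 < t ∧ (t : ℝ) * b ∈ G}.Nonempty := by
    refine ⟨_, z.natAbs, rfl, Int.natAbs_pos.2 hz, ?_⟩
    rcases Int.natAbs_eq z with h | h
    · rw [h] at hzb
      simpa using hzb
    · rw [h] at hzb
      simpa using hzb
  obtain ⟨t, ht, ht0, htb⟩ := csInf_mem hne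
  refine ⟨t, hu.trans ht, ht0, htb, ?_⟩
  rw [Int.dvd_iff_emod_eq_zero]
  by_contra hr
  have hpos : 0 ≤ z % t := Int.emod_nonneg _ (by omega)
  have hlt : z % t < t := Int.emod_lt_of_pos _ (by omega)
  obtain ⟨r, hrz⟩ := Int.eq_ofNat_of_zero_le hpos
  have hrb : (r : ℝ) * b ∈ G := by
    have h1 : (r : ℤ) = z - t * (z / t) := by rw [← hrz, Int.emod_def]
    have h2 : (r : ℝ) = z - t * ((z / t : ℤ) : ℝ) := by exact_mod_cast h1
    have h3 : (r : ℝ) * b = z * b - (z / t : ℤ) • ((t : ℝ) * b) := by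
      rw [h2, zsmul_eq_mul]
      ring
    rw [h3]
    exact sub_mem hzb (zsmul_mem htb _)
  have hle : (t : ℕ∞) ≤ r := ht ▸ csInf_le' ⟨r, rfl, by omega, hrb⟩
  have : t ≤ r := by exact_mod_cast hle
  omega

theorem exists_finsupp_eq {k : ℕ} {A : Vec} (hA : Supp k A) : ∃ a : ℕ →₀ ℕ, ⇑a = A :=
  ⟨Finsupp.onFinset (Finset.Icc 1 k) A fun l hl => by
    by_contra h
    exact hl (hA l (by simp at h; omega)), rfl⟩

theorem wtA_eq_sum (β : ℕ → ℝ) {k : ℕ} {a : ℕ →₀ ℕ} (ha : Supp k a) :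
    wtA β k a = a.sum fun l n => (n : ℝ) * β l := by
  refine (Finsupp.sum_of_support_subset a (fun l hl => ?_)
    (fun l n => (n : ℝ) * β l) (by simp)).symm
  by_contra h
  exact (Finsupp.mem_support_iff.1 hl) (ha l (by rw [Finset.mem_Icc] at h; omega))

theorem sum_sub_sum_eq (β : ℕ → ℝ) {a a' : ℕ →₀ ℕ} {j : ℕ} (h0 : a 0 = a' 0)
    (h : ∀ l, j < l → a l = a' l) :
    (a.sum fun l n => (n : ℝ) * β l) - (a'.sum fun l n => (n : ℝ) * β l) =
      ∑ l ∈ Finset.Icc 1 j, (((a l : ℤ) - a' l : ℤ) : ℝ) * β l := by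
  classical
  set S := a.support ∪ a'.support ∪ Finset.Icc 1 j with hS
  rw [Finsupp.sum_of_support_subset a (s := S) (by intro; simp [hS]; tauto) _ (by simp),
    Finsupp.sum_of_support_subset a' (s := S) (by intro; simp [hS]; tauto) _ (by simp),
    ← Finset.sum_sub_distrib]
  symm
  rw [Finset.sum_subset (s₂ := S) (by intro; simp [hS]; tauto)]
  · refine Finset.sum_congr rfl fun l _ => ?_
    push_cast
    ring
  · intro l _ hl
    have : a l = a' l := by
      rcases Nat.eq_zero_or_pos l with rfl | hl0
      · exact h0
      · exact h l (by simp at hl; omega)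
    simp [this]

theorem exists_top_ne {a a' : ℕ →₀ ℕ} (h : a ≠ a') :
    ∃ j, a j ≠ a' j ∧ ∀ l, j < l → a l = a' l := by
  classical
  obtain ⟨j, hj⟩ := DFunLike.ne_iff.1 h
  have hne : (a.neLocus a').Nonempty := ⟨j, by simpa using hj⟩
  refine ⟨(a.neLocus a').max' hne, by simpa using Finset.max'_mem _ hne, fun l hl => ?_⟩
  by_contra hcon
  exact absurd (Finset.le_max' (a.neLocus a') l (by simpa using hcon)) (by omega)

namespace RSetup

variable {K : Type} [Field K] (d : RSetup K)

theorem m_mono_pred {i : ℕ} (hi : 1 ≤ i) : d.m (i - 1) ≤ d.m i := by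
  by_cases hT : d.T i = 0
  · exact (d.hsz i hi hT).2.ge
  · rcases eq_or_ne (d.s i) ⊤ with hs | hs
    · exact (d.hmtop i hi hT hs).ge
    · obtain ⟨t, ht⟩ := ENat.ne_top_iff_exists.1 hs
      rw [d.hmfin i hi hT t ht.symm]
      exact le_max_left _ _

theorem γ_zmul_mem {i : ℕ} (hi : 1 ≤ i) (hT : d.T i ≠ 0) {z : ℤ} (hz : z ≠ 0)
    (h : (z : ℝ) * d.γ i ∈ ghSubgroup d.β d.γ d.len (i - 1)) :
    d.s i ≠ ⊤ ∧ (z : ℝ) * d.γ i ∈ grSubgroup d.β (d.m i) ⊔ grSubgroup d.γ (i - 1) := by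
  obtain ⟨t, hst, ht0, htg, c, rfl⟩ :=
    exists_eq_natCast_of_zmul_mem (ghSubgroup d.β d.γ d.len (i - 1)) _ (d.hs i hi hT) hz h
  refine ⟨by simp [hst], ?_⟩
  have hne : {j : ℕ | 1 ≤ j ∧ (j : ℕ∞) ≤ d.len ∧
      (t : ℝ) * d.γ i ∈ GrH d.β d.γ j (i - 1)}.Nonempty := by
    obtain ⟨k, hk, hkg⟩ := htg
    refine ⟨max 1 k, le_max_left _ _, ?_, ?_⟩
    · rcases max_choice 1 k with h | h <;> rw [h]
      · exact le_trans (by norm_num) d.hlen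
      · exact hk
    · rw [mem_GrH] at *
      exact sup_le_sup_right (grSubgroup_mono _ (le_max_right 1 k)) _ hkg
  have hmem := mem_GrH.1 (Nat.sInf_mem hne).2.2
  have hm : (t : ℝ) * d.γ i ∈ grSubgroup d.β (d.m i) ⊔ grSubgroup d.γ (i - 1) := by
    refine sup_le_sup_right (grSubgroup_mono _ ?_) _ hmem
    rw [d.hmfin i hi hT t hst]
    exact le_max_right _ _
  have : (((t : ℤ) * c : ℤ) : ℝ) * d.γ i = c • ((t : ℝ) * d.γ i) := by
    rw [zsmul_eq_mul]
    push_cast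
    ring
  rw [this]
  exact zsmul_mem hm c

theorem mem_grSubgroup_of_mem_sup {n k : ℕ} (hn : (n : ℕ∞) ≤ d.len) (hk : (k : ℕ∞) ≤ d.len)
    {g : ℝ} (hg : g ∈ grSubgroup d.β k) (i : ℕ) (hni : d.m i ≤ n)
    (hgi : g ∈ grSubgroup d.β n ⊔ grSubgroup d.γ i) : g ∈ grSubgroup d.β n := by
  induction i with
  | zero =>
    obtain ⟨a, ha, b, ⟨B, -, rfl⟩, rfl⟩ := AddSubgroup.mem_sup.1 hgi
    simpa [wtZ] using ha
  | succ i ih =>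
    refine ih ((d.m_mono_pred (i := i + 1) (by omega)).trans hni) ?_
    obtain ⟨a, ha, b, hb, rfl⟩ := AddSubgroup.mem_sup.1 hgi
    obtain ⟨z, hz⟩ := grSubgroup_succ hb
    have hzm : (z : ℝ) * d.γ (i + 1) ∈ grSubgroup d.β n ⊔ grSubgroup d.γ i := by
      by_cases hT : d.T (i + 1) = 0
      · simp [(d.hγ (i + 1) (by omega)).1 hT]
      · rcases eq_or_ne z 0 with rfl | hz0
        · simp
        · refine sup_le_sup_right (grSubgroup_mono _ hni) _
            (d.γ_zmul_mem (i := i + 1) (by omega) hT hz0 ?_).2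
          have h1 : a + b ∈ ghSubgroup d.β d.γ d.len i :=
            mem_ghSubgroup hk (AddSubgroup.mem_sup_left hg)
          have h2 : a ∈ ghSubgroup d.β d.γ d.len i :=
            mem_ghSubgroup hn (AddSubgroup.mem_sup_left ha)
          have h3 : b - z * d.γ (i + 1) ∈ ghSubgroup d.β d.γ d.len i :=
            mem_ghSubgroup hn (AddSubgroup.mem_sup_right hz)
          have : (z : ℝ) * d.γ (i + 1) = (a + b) - a - (b - z * d.γ (i + 1)) := by ring
          rw [this]
          exact sub_mem (sub_mem h1 h2) h3
    have : a + b = a + (b - z * d.γ (i + 1)) + z * d.γ (i + 1) := by ring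
    rw [this]
    exact add_mem (add_mem (AddSubgroup.mem_sup_left ha) (AddSubgroup.mem_sup_right hz)) hzm

end RSetup

end Jump

namespace Jump.RSetup

variable {K : Type} [Field K] (d : RSetup K)

/-- The exponents `(a, c)` involve only existing `P_j` and nonzero `T_i`. -/
def Admissible (a c : ℕ →₀ ℕ) : Prop :=
  (∀ l, a l ≠ 0 → 1 ≤ l ∧ (l : ℕ∞) ≤ d.len) ∧ ∀ l, c l ≠ 0 → 1 ≤ l ∧ d.T l ≠ 0

/-- The weight of a pair of finitely supported exponents. -/
noncomputable def weight (a c : ℕ →₀ ℕ) : ℝ :=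
  (a.sum fun l n => (n : ℝ) * d.β l) + c.sum fun l n => (n : ℝ) * d.γ l

theorem mem_TchainR {n : ℕ} {p : PVec}
    (hp : p ∈ TchainR d.β d.γ d.q d.s d.m (fun n => d.T n = 0) n) :
    p ∈ Pset d.q ∨
      (∃ i, 1 ≤ i ∧ d.T i = 0 ∧ p = (fun _ => 0, unitVec i)) ∨
      ∃ i, 1 ≤ i ∧ d.T i ≠ 0 ∧ d.s i ≠ ⊤ ∧ p ∈ Dstep d.β d.γ d.s d.m i
        (TchainR d.β d.γ d.q d.s d.m (fun n => d.T n = 0) i) := by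
  induction n with
  | zero => exact Or.inl hp
  | succ n ih =>
    rcases hp with hp | hp
    · exact ih hp
    · unfold Astep at hp
      split_ifs at hp with h0 hT
      · exact hp.elim
      · exact Or.inr (Or.inl ⟨n, by omega, hT, hp⟩)
      · refine Or.inr (Or.inr ⟨n, by omega, hT, fun hs => ?_, hp⟩)
        simp [Dstep, hs] at hp

theorem TchainR_mono :
    Monotone (TchainR d.β d.γ d.q d.s d.m (fun n => d.T n = 0)) :=
  monotone_nat_of_le_succ fun _ => Set.subset_union_left

theorem TchainR_subset_TF (n : ℕ) :
    TchainR d.β d.γ d.q d.s d.m (fun n => d.T n = 0) n ⊆ d.TF :=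
  Set.subset_iUnion (TchainR d.β d.γ d.q d.s d.m (fun n => d.T n = 0)) n

theorem Dstep_subset_TF {i : ℕ} (hi : 1 ≤ i) (hT : d.T i ≠ 0) :
    Dstep d.β d.γ d.s d.m i (TchainR d.β d.γ d.q d.s d.m (fun n => d.T n = 0) i) ⊆ d.TF := by
  refine Set.Subset.trans ?_ (d.TchainR_subset_TF (i + 1))
  intro p hp
  refine Or.inr ?_
  rw [Astep, if_neg (by omega), if_neg hT]
  exact hp

theorem zero_unitVec_mem_TchainR {l i : ℕ} (hl : 1 ≤ l) (hli : l < i) (hT : d.T l = 0) :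
    ((fun _ => 0, unitVec l) : PVec) ∈ TchainR d.β d.γ d.q d.s d.m (fun n => d.T n = 0) i := by
  refine d.TchainR_mono (show l + 1 ≤ i from hli) (Or.inr ?_)
  rw [Astep, if_neg (by omega), if_pos hT]
  rfl

theorem lt_q_of_irr {a : ℕ →₀ ℕ} {C : Vec} (h : Irr d.TF (a, C)) {j t : ℕ} (hj : 2 ≤ j)
    (hq : d.q j = t) : a j < t := by
  by_contra hcon
  refine h (fun l => t * unitVec j l, fun _ => 0)
    (d.TchainR_subset_TF 0 ⟨j, hj, t, hq, rfl⟩) ⟨fun l => ?_, fun _ => Nat.zero_le _⟩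
  rcases eq_or_ne l j with rfl | hl
  · simp [unitVec]
    omega
  · simp [unitVec, hl]

theorem eq_of_sub_mem_grSubgroup {a a' : ℕ →₀ ℕ} {C C' : Vec} (h : Irr d.TF (a, C))
    (h' : Irr d.TF (a', C')) {j : ℕ} (hj : 2 ≤ j) (hjl : (j : ℕ∞) ≤ d.len)
    (hmem : ((a j : ℤ) - a' j : ℤ) * d.β j ∈ grSubgroup d.β (j - 1)) : a j = a' j := by
  by_contra hne
  obtain ⟨t, hqt, ht0, -, hdvd⟩ :=
    exists_eq_natCast_of_zmul_mem (grSubgroup d.β (j - 1)) _ (d.hq j hj hjl)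
      (z := (a j : ℤ) - a' j) (by omega) hmem
  have h1 := d.lt_q_of_irr h hj hqt
  have h2 := d.lt_q_of_irr h' hj hqt
  have h3 := Int.eq_zero_of_abs_lt_dvd hdvd (by rw [abs_lt]; omega)
  omega

theorem exists_bound {a c : ℕ →₀ ℕ} (h : d.Admissible a c) :
    ∃ k : ℕ, (k : ℕ∞) ≤ d.len ∧ Supp k a := by
  refine ⟨a.support.sup id, ?_, ?_⟩
  · refine Finset.sup_induction (p := fun k : ℕ => (k : ℕ∞) ≤ d.len) (by simp) ?_ ?_
    · intro k hk l hl
      rcases max_choice k l with h | h <;> simp only [h] <;> assumption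
    · intro l hl
      exact (h.1 l (by simpa using hl)).2
  · rintro l hl
    by_contra hne
    have h1 := (h.1 l hne).1
    have h2 : l ≤ a.support.sup id := Finset.le_sup (f := id) (by simpa using hne)
    omega

theorem sum_sub_sum_mem {a c a' c' : ℕ →₀ ℕ} (h : d.Admissible a c) (h' : d.Admissible a' c') :
    ∃ k : ℕ, (k : ℕ∞) ≤ d.len ∧
      (a.sum fun l n => (n : ℝ) * d.β l) - (a'.sum fun l n => (n : ℝ) * d.β l) ∈
        grSubgroup d.β k := by
  obtain ⟨k, hk, hka⟩ := d.exists_bound h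
  obtain ⟨k', hk', hka'⟩ := d.exists_bound h'
  refine ⟨max k k', by rcases max_choice k k' with h | h <;> rw [h] <;> assumption, ?_⟩
  rw [sum_sub_sum_eq (j := max k k')]
  · exact sum_mem_grSubgroup _ _ _
  · rw [hka 0 (Or.inl rfl), hka' 0 (Or.inl rfl)]
  · intro l hl
    rw [max_lt_iff] at hl
    rw [hka l (Or.inr hl.1), hka' l (Or.inr hl.2)]

theorem Admissible.apply_zero {a c : ℕ →₀ ℕ} (h : d.Admissible a c) : a 0 = 0 ∧ c 0 = 0 := by
  constructor
  · by_contra hne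
    exact absurd (h.1 0 hne).1 (by omega)
  · by_contra hne
    exact absurd (h.2 0 hne).1 (by omega)

/-- Two irreducible exponents whose `P`-parts differ by an element of `G_n` agree beyond `n`. -/
theorem eq_above {a c a' c' : ℕ →₀ ℕ} (h : d.Admissible a c) (h' : d.Admissible a' c')
    {C C' : Vec} (hI : Irr d.TF (a, C)) (hI' : Irr d.TF (a', C')) {n : ℕ} (hn : 1 ≤ n)
    (hmem : ∀ j, n < j → (j : ℕ∞) ≤ d.len →
      (a.sum fun l n => (n : ℝ) * d.β l) - (a'.sum fun l n => (n : ℝ) * d.β l) ∈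
        grSubgroup d.β (j - 1)) (l : ℕ) (hl : n < l) : a l = a' l := by
  by_contra hne
  obtain ⟨j, hj, htop⟩ := exists_top_ne (a := a) (a' := a') (fun h => hne (by rw [h]))
  have hlj : l ≤ j := by
    by_contra hcon
    exact hne (htop l (by omega))
  have hjl : (j : ℕ∞) ≤ d.len := by
    by_cases h0 : a j = 0
    · exact (h'.1 j (by omega)).2
    · exact (h.1 j h0).2
  refine hj (d.eq_of_sub_mem_grSubgroup hI hI' (by omega) hjl ?_)
  have hs := hmem j (by omega) hjl
  rw [sum_sub_sum_eq d.β (j := j) (by rw [h.apply_zero.1, h'.apply_zero.1]) htop] at hs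
  obtain ⟨k, rfl⟩ : ∃ k, j = k + 1 := ⟨j - 1, by omega⟩
  rw [Finset.sum_Icc_succ_top (by omega)] at hs
  have := sub_mem hs (sum_mem_grSubgroup d.β k fun l => (a l : ℤ) - a' l)
  simpa using this

/-- A pair lying above a pair pushing `γ_i` is reducible. -/
theorem not_irr_of_push {i : ℕ} (hi : 1 ≤ i) (hT : d.T i ≠ 0) (hs : d.s i ≠ ⊤)
    {B D : ℕ →₀ ℕ} {p : PVec} (hB : Supp (d.m i) B) (hD : Supp i D)
    (hpush : Push d.β d.γ (d.m i) i (B, D)) (hBp : ⇑B ≤ p.1) (hDp : ⇑D ≤ p.2) :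
    ¬ Irr d.TF p := by
  intro hirr
  obtain ⟨⟨B₀, D₀⟩, ⟨hle, hpush₀⟩, hmin⟩ := WellFounded.has_min
    (wellFounded_lt (α := (ℕ →₀ ℕ) × (ℕ →₀ ℕ)))
    {r | r ≤ (B, D) ∧ Push d.β d.γ (d.m i) i (r.1, r.2)} ⟨(B, D), le_rfl, hpush⟩
  have hB₀ : ⇑B₀ ≤ B := hle.1
  have hD₀ : ⇑D₀ ≤ D := hle.2
  have hB₀s : Supp (d.m i) B₀ := fun l hl => Nat.le_zero.1 ((hB₀ l).trans (hB l hl).le)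
  have hD₀s : Supp i D₀ := fun l hl => Nat.le_zero.1 ((hD₀ l).trans (hD l hl).le)
  refine hirr (B₀, D₀) (d.Dstep_subset_TF hi hT ?_) ⟨hB₀.trans hBp, hD₀.trans hDp⟩
  rw [Dstep, if_neg hs]
  refine ⟨hB₀s, hD₀s, ?_, hpush₀, ?_⟩
  · intro bd hbd hcon
    exact hirr bd (d.TchainR_subset_TF i hbd)
      ⟨hcon.1.trans (hB₀.trans hBp), hcon.2.trans (hD₀.trans hDp)⟩
  · rintro ⟨B₁, D₁⟩ hB₁ hD₁ hne hpush₁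
    dsimp only at hB₁ hD₁
    obtain ⟨B₁, rfl⟩ := exists_finsupp_eq (k := d.m i) (A := B₁)
      fun l hl => Nat.le_zero.1 ((hB₁ l).trans (hB₀s l hl).le)
    obtain ⟨D₁, rfl⟩ := exists_finsupp_eq (k := i) (A := D₁)
      fun l hl => Nat.le_zero.1 ((hD₁ l).trans (hD₀s l hl).le)
    have hle₁ : (B₁, D₁) ≤ (B₀, D₀) := ⟨hB₁, hD₁⟩
    refine hmin (B₁, D₁) ⟨hle₁.trans hle, hpush₁⟩ (lt_of_le_of_ne hle₁ fun heq => hne ?_)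
    rw [Prod.mk.injEq] at heq
    rw [heq.1, heq.2]

theorem not_lt_at_top {a c a' c' : ℕ →₀ ℕ} (h : d.Admissible a c) (h' : d.Admissible a' c')
    (hI : Irr d.TF (a, c)) (hI' : Irr d.TF (a', c')) (hw : d.weight a c = d.weight a' c')
    {i : ℕ} (htop : ∀ l, i < l → c l = c' l) : ¬ c' i < c i := by
  intro hlt
  obtain ⟨hi, hT⟩ := h.2 i (by omega)
  set X := (a.sum fun l n => (n : ℝ) * d.β l) - (a'.sum fun l n => (n : ℝ) * d.β l) with hX
  have hsum : X + ∑ l ∈ Finset.Icc 1 i, (((c l : ℤ) - c' l : ℤ) : ℝ) * d.γ l = 0 := by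
    rw [hX, ← sum_sub_sum_eq d.γ (by rw [h.apply_zero.2, h'.apply_zero.2]) htop]
    unfold weight at hw
    linarith
  obtain ⟨k, hk, hXk⟩ := d.sum_sub_sum_mem h h'
  rw [← hX] at hXk
  obtain ⟨e, rfl⟩ : ∃ e, i = e + 1 := ⟨i - 1, by omega⟩
  rw [Finset.sum_Icc_succ_top (by omega)] at hsum
  have hlow := sum_mem_grSubgroup d.γ e fun l => (c l : ℤ) - c' l
  set Y := ∑ l ∈ Finset.Icc 1 e, (((c l : ℤ) - c' l : ℤ) : ℝ) * d.γ l with hY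
  have hz : (((c (e + 1) : ℤ) - c' (e + 1) : ℤ) : ℝ) * d.γ (e + 1) = -(X + Y) := by linarith
  obtain ⟨hs, hzm⟩ := d.γ_zmul_mem hi hT (z := (c (e + 1) : ℤ) - c' (e + 1)) (by omega) (by
    rw [hz]
    exact neg_mem (add_mem (mem_ghSubgroup hk (AddSubgroup.mem_sup_left hXk))
      (mem_ghSubgroup hk (AddSubgroup.mem_sup_right hlow))))
  simp only [Nat.add_sub_cancel] at hzm
  have hXm : X ∈ grSubgroup d.β (d.m (e + 1)) ⊔ grSubgroup d.γ e := by
    rw [hz] at hzm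
    have := sub_mem (neg_mem hzm)
      (AddSubgroup.mem_sup_right (S := grSubgroup d.β (d.m (e + 1))) hlow)
    rwa [neg_neg, add_sub_cancel_right] at this
  have habove : ∀ l, d.m (e + 1) < l → a l = a' l := by
    refine d.eq_above h h' hI hI' (d.hmlen (e + 1)).1 fun j hj hjl => ?_
    have hjm : d.m (e + 1) ≤ j - 1 := by omega
    have hjl' : ((j - 1 : ℕ) : ℕ∞) ≤ d.len :=
      le_trans (by exact_mod_cast Nat.sub_le j 1) hjl
    exact d.mem_grSubgroup_of_mem_sup hjl' hk hXk e
      ((d.m_mono_pred hi).trans hjm) (sup_le_sup_right (grSubgroup_mono _ hjm) _ hXm)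
  set M := d.m (e + 1) with hM
  have hXs : X = ∑ l ∈ Finset.Icc 1 M, (((a l : ℤ) - a' l : ℤ) : ℝ) * d.β l :=
    sum_sub_sum_eq d.β (by rw [h.apply_zero.1, h'.apply_zero.1]) habove
  have hBs : Supp M fun l => if l ≤ M then a l else 0 := by
    rintro l (rfl | hl)
    · simp [h.apply_zero.1]
    · simp [hl.not_ge]
  have hDs : Supp (e + 1) fun l =>
      if l < e + 1 then c l else if l = e + 1 then c l - c' l else 0 := by
    rintro l (rfl | hl)
    · simp [h.apply_zero.2]
    · simp only [if_neg (show ¬ l < e + 1 by omega), if_neg (show l ≠ e + 1 by omega)]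
  obtain ⟨B, hB⟩ := exists_finsupp_eq hBs
  obtain ⟨D, hD⟩ := exists_finsupp_eq hDs
  refine d.not_irr_of_push hi hT hs (B := B) (D := D) (p := (a, c)) (hB ▸ hBs) (hD ▸ hDs)
    ⟨?_, ?_⟩ ?_ ?_ hI
  · simp [hD]
    omega
  · refine ⟨∑ l ∈ Finset.Icc 1 M, (a' l : ℝ) * d.β l,
      ⟨fun l => if l ≤ M then a' l else 0, ?_, ?_⟩,
      ∑ l ∈ Finset.Icc 1 e, (c' l : ℝ) * d.γ l,
      ⟨fun l => if l ≤ e then c' l else 0, ?_, ?_⟩, ?_⟩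
    · rintro l (rfl | hl)
      · simp [h'.apply_zero.1]
      · simp only [if_neg (show ¬ l ≤ M from hl.not_ge)]
    · refine Finset.sum_congr rfl fun l hl => ?_
      simp only [if_pos (show l ≤ M from (Finset.mem_Icc.1 hl).2)]
    · rintro l (rfl | hl)
      · simp [h'.apply_zero.2]
      · simp at hl
        simp [hl]
    · refine Finset.sum_congr rfl fun l hl => ?_
      simp only [if_pos (show l ≤ e from (Finset.mem_Icc.1 hl).2)]
    · have e1 : wtA d.β M B = ∑ l ∈ Finset.Icc 1 M, (a l : ℝ) * d.β l :=
        Finset.sum_congr rfl fun l hl => by simp [hB, (Finset.mem_Icc.1 hl).2]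
      have e2 : wtA d.γ (e + 1) D = ∑ l ∈ Finset.Icc 1 e, (c l : ℝ) * d.γ l +
          ((c (e + 1) : ℝ) - c' (e + 1)) * d.γ (e + 1) := by
        rw [wtA, Finset.sum_Icc_succ_top (by omega)]
        congr 1
        · exact Finset.sum_congr rfl fun l hl => by
            simp [hD, Nat.lt_succ_of_le (Finset.mem_Icc.1 hl).2]
        · simp [hD, Nat.cast_sub hlt.le]
      rw [wt, e1, e2]
      have e3 : X = ∑ l ∈ Finset.Icc 1 M, (a l : ℝ) * d.β l -
          ∑ l ∈ Finset.Icc 1 M, (a' l : ℝ) * d.β l := by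
        rw [hXs, ← Finset.sum_sub_distrib]
        exact Finset.sum_congr rfl fun l _ => by push_cast; ring
      have e4 : Y = ∑ l ∈ Finset.Icc 1 e, (c l : ℝ) * d.γ l -
          ∑ l ∈ Finset.Icc 1 e, (c' l : ℝ) * d.γ l := by
        rw [hY, ← Finset.sum_sub_distrib]
        exact Finset.sum_congr rfl fun l _ => by push_cast; ring
      push_cast at hz
      linarith
  · intro l
    simp only [hB]
    split_ifs <;> simp
  · intro l
    simp only [hD]
    split_ifs <;> simp

/-- An irreducible pair of exponents is determined by its weight. -/
theorem eq_of_irr_of_weight_eq {a c a' c' : ℕ →₀ ℕ} (h : d.Admissible a c)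
    (h' : d.Admissible a' c') (hI : Irr d.TF (a, c)) (hI' : Irr d.TF (a', c'))
    (hw : d.weight a c = d.weight a' c') : a = a' ∧ c = c' := by
  have hc : c = c' := by
    by_contra hne
    obtain ⟨i, hi, htop⟩ := exists_top_ne hne
    rcases lt_or_gt_of_ne hi with hlt | hlt
    · exact d.not_lt_at_top h' h hI' hI hw.symm (fun l hl => (htop l hl).symm) hlt
    · exact d.not_lt_at_top h h' hI hI' hw htop hlt
  subst hc
  refine ⟨?_, rfl⟩
  have hw' : (a.sum fun l n => (n : ℝ) * d.β l) - (a'.sum fun l n => (n : ℝ) * d.β l) = 0 := by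
    unfold weight at hw
    linarith
  have habove := d.eq_above h h' hI hI' le_rfl fun j _ _ => by
    rw [hw']
    exact zero_mem _
  have h1 := hw'.symm.trans
    (sum_sub_sum_eq d.β (j := 1) (by rw [h.apply_zero.1, h'.apply_zero.1]) habove)
  have hβ1 : d.β 1 ≠ 0 := by
    rw [d.hβ 1 le_rfl (le_trans (by norm_num) d.hlen), d.hP1]
    exact d.hνx.ne'
  ext l
  rcases lt_trichotomy l 1 with hl | rfl | hl
  · obtain rfl : l = 0 := by omega
    rw [h.apply_zero.1, h'.apply_zero.1]
  · simp only [Finset.Icc_self, Finset.sum_singleton, zero_eq_mul, hβ1, or_false] at h1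
    have h2 : ((a 1 : ℤ) - a' 1 : ℤ) = 0 := by exact_mod_cast h1
    omega
  · exact habove l hl

end Jump.RSetup

namespace Jump.RSetup

variable {K : Type} [Field K] (d : RSetup K)

open Classical in
/-- The valuation `ν` extended by `ν(0) = ∞`. -/
noncomputable def val : AddValuation K (WithTop ℝ) :=
  AddValuation.of (fun f => if f = 0 then ⊤ else (d.ν f : WithTop ℝ)) (by simp)
    (by
      have h := d.hmul 1 1 one_ne_zero one_ne_zero
      rw [mul_one] at h
      have h0 : d.ν 1 = 0 := by linarith
      simp [h0])
    (by
      intro f g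
      by_cases hf : f = 0
      · simp [hf]
      by_cases hg : g = 0
      · simp [hg]
      by_cases hfg : f + g = 0
      · simp [hfg]
      · simp only [hf, hg, hfg, if_false]
        exact_mod_cast d.hadd f g hf hg hfg)
    (by
      intro f g
      by_cases hf : f = 0
      · simp [hf]
      by_cases hg : g = 0
      · simp [hg]
      simp only [mul_eq_zero, hf, hg, or_self, if_false]
      exact_mod_cast d.hmul f g hf hg)

theorem val_of_ne {f : K} (hf : f ≠ 0) : d.val f = (d.ν f : WithTop ℝ) := if_neg hf

theorem val_nonneg {f : K} (hf : f ∈ d.R) : 0 ≤ d.val f := by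
  by_cases h : f = 0
  · simp [h]
  · rw [d.val_of_ne h]
    exact_mod_cast d.hdom f hf h

theorem le_val_iff {f : K} {τ : ℝ} : (τ : WithTop ℝ) ≤ d.val f ↔ f = 0 ∨ τ ≤ d.ν f := by
  by_cases h : f = 0
  · simp [h]
  · rw [d.val_of_ne h]
    simp [h]

theorem val_prod (S : Finset ℕ) (F : ℕ → K) (w : ℕ → ℝ) (n : ℕ → ℕ)
    (h : ∀ l ∈ S, n l ≠ 0 → d.val (F l) = w l) :
    d.val (∏ l ∈ S, F l ^ n l) = ((∑ l ∈ S, (n l : ℝ) * w l : ℝ) : WithTop ℝ) := by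
  induction S using Finset.cons_induction with
  | empty => simp
  | cons i S hi ih =>
    rw [Finset.prod_cons, Finset.sum_cons, AddValuation.map_mul, WithTop.coe_add,
      ih fun l hl => h l (Finset.mem_cons_of_mem hl)]
    congr 1
    by_cases hn : n i = 0
    · simp [hn]
    · rw [AddValuation.map_pow, h i (Finset.mem_cons_self _ _) hn, ← WithTop.coe_nsmul,
        nsmul_eq_mul]

theorem val_P {j : ℕ} (hj : 1 ≤ j) (hjl : (j : ℕ∞) ≤ d.len) : d.val (d.P j) = d.β j := by
  rw [d.val_of_ne (d.hPne j hj hjl), d.hβ j hj hjl]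

theorem val_T {i : ℕ} (hi : 1 ≤ i) (hT : d.T i ≠ 0) : d.val (d.T i) = d.γ i := by
  rw [d.val_of_ne hT, (d.hγ i hi).2 hT]

/-- The monomial `P^a T^c`. -/
noncomputable def mono (a c : ℕ →₀ ℕ) : K :=
  (a.prod fun l n => d.P l ^ n) * c.prod fun l n => d.T l ^ n

theorem mono_add (a c a' c' : ℕ →₀ ℕ) :
    d.mono (a + a') (c + c') = d.mono a c * d.mono a' c' := by
  unfold mono
  rw [Finsupp.prod_add_index' (by simp) (by intros; rw [pow_add]),
    Finsupp.prod_add_index' (by simp) (by intros; rw [pow_add])]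
  ring

theorem weight_add (a c a' c' : ℕ →₀ ℕ) :
    d.weight (a + a') (c + c') = d.weight a c + d.weight a' c' := by
  unfold weight
  rw [Finsupp.sum_add_index' (by simp) (by intros; push_cast; ring),
    Finsupp.sum_add_index' (by simp) (by intros; push_cast; ring)]
  ring

variable {d} in
theorem Admissible.add {a c a' c' : ℕ →₀ ℕ} (h : d.Admissible a c) (h' : d.Admissible a' c') :
    d.Admissible (a + a') (c + c') := by
  constructor
  · intro l hl
    by_cases h0 : a l = 0
    · exact h'.1 l (by simpa [h0] using hl)
    · exact h.1 l h0
  · intro l hl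
    by_cases h0 : c l = 0
    · exact h'.2 l (by simpa [h0] using hl)
    · exact h.2 l h0

variable {d} in
theorem Admissible.of_le {a c a' c' : ℕ →₀ ℕ} (h : d.Admissible a c) (ha : a' ≤ a)
    (hc : c' ≤ c) : d.Admissible a' c' :=
  ⟨fun l hl => h.1 l fun h0 => hl (Nat.le_zero.1 (h0 ▸ ha l)),
    fun l hl => h.2 l fun h0 => hl (Nat.le_zero.1 (h0 ▸ hc l))⟩

theorem val_mono {a c : ℕ →₀ ℕ} (h : d.Admissible a c) :
    d.val (d.mono a c) = (d.weight a c : WithTop ℝ) := by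
  rw [mono, weight, AddValuation.map_mul, WithTop.coe_add]
  congr 1
  · exact d.val_prod _ _ _ _ fun l _ hl => d.val_P (h.1 l hl).1 (h.1 l hl).2
  · exact d.val_prod _ _ _ _ fun l _ hl => d.val_T (h.2 l hl).1 (h.2 l hl).2

theorem mono_mem {a c : ℕ →₀ ℕ} (h : d.Admissible a c) : d.mono a c ∈ d.R := by
  refine mul_mem (prod_mem fun l hl => pow_mem ?_ _) (prod_mem fun l hl => pow_mem ?_ _)
  · have := h.1 l (by simpa using hl)
    exact d.hPmem l this.1 this.2
  · exact d.hTmem l (h.2 l (by simpa using hl)).1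

/-- The ideal generated by the nonzero monomials of weight at least `τ`. -/
noncomputable def monoIdeal (τ : ℝ) : Submodule d.R K :=
  Submodule.span d.R {f | ∃ a c, d.Admissible a c ∧ τ ≤ d.weight a c ∧ f = d.mono a c}

/-- The ideal generated by the nonzero monomials of weight greater than `τ`. -/
noncomputable def monoIdealPlus (τ : ℝ) : Submodule d.R K :=
  Submodule.span d.R {f | ∃ a c, d.Admissible a c ∧ τ < d.weight a c ∧ f = d.mono a c}

theorem mono_mem_monoIdealPlus {τ : ℝ} {a c : ℕ →₀ ℕ} (h : d.Admissible a c)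
    (hτ : τ < d.weight a c) : d.mono a c ∈ d.monoIdealPlus τ :=
  Submodule.subset_span ⟨a, c, h, hτ, rfl⟩

theorem lt_val_of_mem_monoIdealPlus {τ : ℝ} {f : K} (hf : f ∈ d.monoIdealPlus τ) :
    (τ : WithTop ℝ) < d.val f := by
  induction hf using Submodule.span_induction with
  | mem f hf =>
    obtain ⟨a, c, h, hτ, rfl⟩ := hf
    rw [d.val_mono h]
    exact_mod_cast hτ
  | zero => simp
  | add f g _ _ hf hg => exact AddValuation.map_lt_add _ hf hg
  | smul r f _ hf =>
    rw [Subring.smul_def, smul_eq_mul, AddValuation.map_mul]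
    exact lt_of_lt_of_le hf (le_add_of_nonneg_left (d.val_nonneg r.2))

theorem mul_mem_monoIdealPlus {τ : ℝ} {f : K} (hf : f ∈ d.monoIdealPlus τ) {b e : ℕ →₀ ℕ}
    (h : d.Admissible b e) : f * d.mono b e ∈ d.monoIdealPlus (τ + d.weight b e) := by
  induction hf using Submodule.span_induction with
  | mem f hf =>
    obtain ⟨a, c, h', hτ, rfl⟩ := hf
    rw [← d.mono_add]
    exact d.mono_mem_monoIdealPlus (h'.add h) (by rw [d.weight_add]; linarith)
  | zero => simp
  | add f g _ _ hf hg =>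
    rw [add_mul]
    exact add_mem hf hg
  | smul r f _ hf =>
    rw [smul_mul_assoc]
    exact Submodule.smul_mem _ r hf

theorem mul_mem_of_mem_R {M : Submodule d.R K} {r f : K} (hr : r ∈ d.R) (hf : f ∈ M) :
    r * f ∈ M :=
  M.smul_mem (⟨r, hr⟩ : d.R) hf

theorem mono_single_P (j n : ℕ) : d.mono (Finsupp.single j n) 0 = d.P j ^ n := by
  simp [mono]

theorem mono_single_T (i n : ℕ) : d.mono 0 (Finsupp.single i n) = d.T i ^ n := by
  simp [mono]

theorem weight_single_P (j n : ℕ) : d.weight (Finsupp.single j n) 0 = n * d.β j := by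
  simp [weight]

theorem weight_single_T (i n : ℕ) : d.weight 0 (Finsupp.single i n) = n * d.γ i := by
  simp [weight]

theorem admissible_single_P {j : ℕ} (hj : 1 ≤ j) (hjl : (j : ℕ∞) ≤ d.len) (n : ℕ) :
    d.Admissible (Finsupp.single j n) 0 := by
  refine ⟨fun l hl => ?_, fun l hl => by simp at hl⟩
  obtain rfl : l = j := by
    by_contra hne
    exact hl (Finsupp.single_eq_of_ne hne)
  exact ⟨hj, hjl⟩

theorem admissible_single_T {i : ℕ} (hi : 1 ≤ i) (hT : d.T i ≠ 0) (n : ℕ) :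
    d.Admissible 0 (Finsupp.single i n) := by
  refine ⟨fun l hl => by simp at hl, fun l hl => ?_⟩
  obtain rfl : l = i := by
    by_contra hne
    exact hl (Finsupp.single_eq_of_ne hne)
  exact ⟨hi, hT⟩

theorem prod_Icc_eq (F : ℕ → K) {k : ℕ} {a : ℕ →₀ ℕ} (ha : Supp k a) :
    ∏ l ∈ Finset.Icc 1 k, F l ^ a l = a.prod fun l n => F l ^ n := by
  refine (Finsupp.prod_of_support_subset a (fun l hl => ?_) (fun l n => F l ^ n)
    (by simp)).symm
  by_contra h
  exact (Finsupp.mem_support_iff.1 hl) (ha l (by rw [Finset.mem_Icc] at h; omega))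

theorem q_pos {j t : ℕ} (hj : 2 ≤ j) (hjl : (j : ℕ∞) ≤ d.len) (ht : d.q j = t) :
    0 < t := by
  have hq := d.hq j hj hjl
  by_contra h0
  obtain rfl : t = 0 := by omega
  have hne : {u : ℕ∞ | ∃ t : ℕ, u = (t : ℕ∞) ∧ 0 < t ∧
      (t : ℝ) * d.β j ∈ Gr d.β (j - 1)}.Nonempty := by
    by_contra hcon
    rw [Set.not_nonempty_iff_eq_empty] at hcon
    rw [hcon, sInf_empty, ht] at hq
    simp at hq
  obtain ⟨u, hu, hu0, -⟩ := csInf_mem hne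
  rw [← hq, ht] at hu
  have : (0 : ℕ) = u := by exact_mod_cast hu
  omega

/-- A rewriting rule `(B, D) → (L, N)`, with scalar `t`: the two monomials have the same weight
and agree up to `t` modulo monomials of larger weight. -/
def Rule (B D L N : ℕ →₀ ℕ) (t : K) : Prop :=
  d.Admissible L N ∧ d.weight L N = d.weight B D ∧ t ∈ d.kk ∧
    d.mono B D - t * d.mono L N ∈ d.monoIdealPlus (d.weight B D)

variable {d} in
theorem Rule.extend {B D L N : ℕ →₀ ℕ} {t : K} (h : d.Rule B D L N t) {a c : ℕ →₀ ℕ}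
    (hac : d.Admissible a c) (hB : B ≤ a) (hD : D ≤ c) :
    d.Rule a c (a - B + L) (c - D + N) t := by
  obtain ⟨hLN, hw, ht, hmem⟩ := h
  have hsub : d.Admissible (a - B) (c - D) := hac.of_le tsub_le_self tsub_le_self
  have hadd : a - B + B = a ∧ c - D + D = c := ⟨tsub_add_cancel_of_le hB, tsub_add_cancel_of_le hD⟩
  have hwac : d.weight a c = d.weight B D + d.weight (a - B) (c - D) := by
    conv_lhs => rw [← hadd.1, ← hadd.2]
    rw [d.weight_add, add_comm]
  refine ⟨hsub.add hLN, ?_, ht, ?_⟩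
  · rw [d.weight_add, hw, hwac, add_comm]
  · have hm : d.mono a c = d.mono B D * d.mono (a - B) (c - D) := by
      conv_lhs => rw [← hadd.1, ← hadd.2]
      rw [d.mono_add, mul_comm]
    have := d.mul_mem_monoIdealPlus hmem hsub
    rw [hwac, hm, d.mono_add]
    convert this using 1
    ring

variable {d} in
theorem Rule.refl {a c : ℕ →₀ ℕ} (h : d.Admissible a c) : d.Rule a c a c 1 :=
  ⟨h, rfl, one_mem _, by simp⟩

variable {d} in
theorem Rule.trans {a c a' c' a'' c'' : ℕ →₀ ℕ} {t t' : K} (h : d.Rule a c a' c' t)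
    (h' : d.Rule a' c' a'' c'' t') : d.Rule a c a'' c'' (t * t') := by
  refine ⟨h'.1, h'.2.1.trans h.2.1, mul_mem h.2.2.1 h'.2.2.1, ?_⟩
  have h1 := d.mul_mem_of_mem_R (d.hkR h.2.2.1) h'.2.2.2
  rw [h.2.1] at h1
  have := add_mem h.2.2.2 h1
  convert this using 1
  ring

theorem exists_rule_P {j t : ℕ} (hj : 2 ≤ j) (hq : d.q j = t) :
    ∃ (L : ℕ →₀ ℕ) (u : K), Supp (j - 1) L ∧ d.Rule (Finsupp.single j t) 0 L 0 u := by
  have hjl : (j : ℕ∞) ≤ d.len := by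
    by_contra hcon
    rw [d.hqtop j (not_le.1 hcon)] at hq
    exact absurd hq (by simp)
  have hjl' : ((j + 1 : ℕ) : ℕ∞) ≤ d.len := by
    have hne : d.len ≠ (j : ℕ∞) := fun h => by
      rw [(d.hlast j hj hjl).2 h] at hq
      exact absurd hq (by simp)
    have := Order.add_one_le_of_lt (lt_of_le_of_ne hjl hne.symm)
    exact_mod_cast this
  obtain ⟨lam, LL, hlam, -, hLs, -, hw, hP, hν⟩ := d.hPrec j hj hjl t hq
  obtain ⟨L, rfl⟩ := exists_finsupp_eq hLs
  have hL : d.Admissible L 0 := by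
    refine ⟨fun l hl => ?_, fun l hl => by simp at hl⟩
    have hlj : 1 ≤ l ∧ l ≤ j - 1 := by
      by_contra hcon
      exact hl (hLs l (by omega))
    refine ⟨hlj.1, le_trans ?_ hjl⟩
    exact_mod_cast (by omega : l ≤ j)
  refine ⟨L, lam, hLs, hL, ?_, hlam, ?_⟩
  · rw [d.weight_single_P, hw, wtA_eq_sum _ hLs, weight]
    simp
  · have hmono : d.mono L 0 = ∏ l ∈ Finset.Icc 1 (j - 1), d.P l ^ L l := by
      rw [prod_Icc_eq _ hLs, mono]
      simp
    have : d.mono (Finsupp.single j t) 0 - lam * d.mono L 0 =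
        d.mono (Finsupp.single (j + 1) 1) 0 := by
      rw [hmono, d.mono_single_P, d.mono_single_P, pow_one, hP]
    rw [this]
    refine d.mono_mem_monoIdealPlus (d.admissible_single_P (by omega) hjl' 1) ?_
    rw [d.weight_single_P, d.weight_single_P, d.hβ (j + 1) (by omega) hjl']
    simpa using hν

theorem exists_rule_T {i : ℕ} (hi : 1 ≤ i) (hT : d.T i ≠ 0) (hs : d.s i ≠ ⊤) {B D : ℕ →₀ ℕ}
    (hBD : ((B, D) : PVec) ∈ Dstep d.β d.γ d.s d.m i
      (TchainR d.β d.γ d.q d.s d.m (fun n => d.T n = 0) i)) :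
    ∃ (L N : ℕ →₀ ℕ) (u : K), Supp (i - 1) N ∧ d.Rule B D L N u := by
  obtain ⟨e, -, he⟩ := d.hTrec i hi hT hs
  have hBD' : ((B, D) : PVec) ∈ DsetR d.β d.γ d.s d.m (fun n => d.T n = 0) i
      (TchainR d.β d.γ d.q d.s d.m (fun n => d.T n = 0) i) := by
    rw [DsetR, if_neg hT]
    exact hBD
  obtain ⟨LL, NN, mu, hL, hN, hirr, hw, hmu, -, hrec, hval⟩ := he ⟨_, hBD'⟩
  rw [Dstep, if_neg hs] at hBD
  obtain ⟨hBs, hDs, -, -⟩ := hBD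
  dsimp only at hBs hDs hw hrec hval
  obtain ⟨L, rfl⟩ := exists_finsupp_eq hL
  obtain ⟨N, rfl⟩ := exists_finsupp_eq hN
  have hadm : d.Admissible L N := by
    constructor
    · intro l hl
      have hlj : 1 ≤ l ∧ l ≤ d.m i := by
        by_contra hcon
        exact hl (hL l (by omega))
      exact ⟨hlj.1, le_trans (by exact_mod_cast hlj.2) (d.hmlen i).2⟩
    · intro l hl
      have hlj : 1 ≤ l ∧ l ≤ i - 1 := by
        by_contra hcon
        exact hl (hN l (by omega))
      refine ⟨hlj.1, fun hT0 => ?_⟩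
      refine hirr _ (d.zero_unitVec_mem_TchainR hlj.1 (by omega) hT0)
        ⟨fun _ => Nat.zero_le _, fun l' => ?_⟩
      rcases eq_or_ne l' l with rfl | hne
      · simp [unitVec]
        omega
      · simp [unitVec, hne]
  have hwBD : wt d.β d.γ (d.m i) i (B, D) = d.weight B D := by
    rw [wt, wtA_eq_sum _ hBs, wtA_eq_sum _ hDs, weight]
  have hwLN : wt d.β d.γ (d.m i) (i - 1) (L, N) = d.weight L N := by
    rw [wt, wtA_eq_sum _ hL, wtA_eq_sum _ hN, weight]
  rw [hwBD] at hval
  refine ⟨L, N, mu, hN, hadm, by rw [← hwLN, hw, hwBD], hmu, ?_⟩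
  rw [prod_Icc_eq _ hBs, prod_Icc_eq _ hDs, mul_assoc, prod_Icc_eq _ hL, prod_Icc_eq _ hN]
    at hrec
  unfold mono
  rw [← hrec]
  by_cases h0 : d.T ((∑ j ∈ Finset.range i, d.δ j) + (e ⟨_, hBD'⟩ : ℕ) + 1) = 0
  · rw [h0]
    exact zero_mem _
  · have h1 := hval.resolve_left h0
    rw [← (d.hγ _ (by omega)).2 h0] at h1
    rw [← pow_one (d.T _), ← d.mono_single_T]
    refine d.mono_mem_monoIdealPlus (d.admissible_single_T (by omega) h0 1) ?_
    rw [d.weight_single_T]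
    simpa using h1

theorem lex_lt {j : ℕ} {a B L : ℕ →₀ ℕ} (hj : 1 ≤ j) (hB : B ≤ a) (hBj : B j ≠ 0)
    (hBs : Supp j B) (hL : Supp (j - 1) L) :
    Finsupp.Lex (· > ·) (· < ·) (a - B + L) a := by
  refine ⟨j, fun l hl => ?_, ?_⟩
  · simp [hBs l (Or.inr hl), hL l (Or.inr (by omega))]
  · have := hB j
    simp only [Finsupp.coe_add, Finsupp.coe_tsub, Pi.add_apply, Pi.sub_apply,
      hL j (Or.inr (by omega))]
    omega

/-- A reducible monomial is rewritten to a smaller one in the reverse lexicographic order. -/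
theorem exists_rule_of_not_irr {a c : ℕ →₀ ℕ} (h : d.Admissible a c)
    (hI : ¬ Irr d.TF (a, c)) :
    ∃ (a' c' : ℕ →₀ ℕ) (u : K), d.Rule a c a' c' u ∧
      Prod.Lex (Finsupp.Lex (· > ·) (· < ·)) (Finsupp.Lex (· > ·) (· < ·)) (c', a') (c, a) := by
  simp only [Irr, not_forall, not_not] at hI
  obtain ⟨p, hp, hpa, hpc⟩ := hI
  obtain ⟨n, hp⟩ := Set.mem_iUnion.1 hp
  rcases d.mem_TchainR hp with ⟨j, hj, t, hq, rfl⟩ | ⟨i, hi, hT, rfl⟩ | ⟨i, hi, hT, hs, hmem⟩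
  · obtain ⟨L, u, hL, hrule⟩ := d.exists_rule_P hj hq
    have hjl : (j : ℕ∞) ≤ d.len := by
      by_contra hcon
      rw [d.hqtop j (not_le.1 hcon)] at hq
      exact absurd hq (by simp)
    have ht := d.q_pos hj hjl hq
    have hle : Finsupp.single j t ≤ a := by
      rw [Finsupp.single_le_iff]
      simpa [unitVec] using hpa j
    refine ⟨_, _, u, hrule.extend h hle zero_le, ?_⟩
    simp only [tsub_zero, add_zero]
    refine Prod.Lex.right _ (lex_lt (by omega) hle (by simp; omega) (fun l hl => ?_) hL)
    exact Finsupp.single_eq_of_ne (by omega)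
  · exact absurd hT (h.2 i (by
      have := hpc i
      simp [unitVec] at this
      omega)).2
  · obtain ⟨B, D⟩ := p
    have hmem' := hmem
    rw [Dstep, if_neg hs] at hmem'
    obtain ⟨hBs, hDs, -, hred⟩ := hmem'
    dsimp only at hBs hDs hpa hpc
    obtain ⟨B, rfl⟩ := exists_finsupp_eq hBs
    obtain ⟨D, rfl⟩ := exists_finsupp_eq hDs
    obtain ⟨L, N, u, hN, hrule⟩ := d.exists_rule_T hi hT hs hmem
    refine ⟨_, _, u, hrule.extend h hpa hpc, Prod.Lex.left _ _ ?_⟩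
    exact lex_lt hi hpc (Nat.pos_iff_ne_zero.1 hred.1.1) hDs hN

theorem exists_rule_irr {a c : ℕ →₀ ℕ} (h : d.Admissible a c) :
    ∃ (a' c' : ℕ →₀ ℕ) (u : K), d.Rule a c a' c' u ∧ Irr d.TF (a', c') := by
  have hwf : WellFounded (Finsupp.Lex (α := ℕ) (N := ℕ) (· > ·) (· < ·)) :=
    Finsupp.Lex.wellFounded' (fun n => Nat.not_lt_zero n) wellFounded_lt wellFounded_lt
  obtain ⟨p, hp⟩ : ∃ p : (ℕ →₀ ℕ) × (ℕ →₀ ℕ), p = (c, a) := ⟨_, rfl⟩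
  induction p using (hwf.prod_lex hwf).induction generalizing a c with
  | _ p ih =>
    subst hp
    by_cases hI : Irr d.TF (a, c)
    · exact ⟨a, c, 1, Rule.refl h, hI⟩
    · obtain ⟨a₁, c₁, u₁, hr₁, hlt⟩ := d.exists_rule_of_not_irr h hI
      obtain ⟨a₂, c₂, u₂, hr₂, hI₂⟩ := ih (c₁, a₁) hlt hr₁.1 rfl
      exact ⟨a₂, c₂, u₁ * u₂, hr₁.trans hr₂, hI₂⟩

end Jump.RSetup

namespace Jump.RSetup

variable {K : Type} [Field K] (d : RSetup K)

theorem exists_residue {r : K} (hr : r ∈ d.R) : ∃ t ∈ d.kk, 0 < d.val (r - t) := by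
  by_cases h0 : r = 0
  · exact ⟨0, zero_mem _, by simp [h0]⟩
  · obtain ⟨t, ht, h⟩ := d.hres r h0 (d.hdom r hr h0)
    refine ⟨t, ht, ?_⟩
    by_cases hrt : r - t = 0
    · simp [hrt]
    · rw [d.val_of_ne hrt]
      exact_mod_cast h.resolve_left hrt

theorem val_of_mem_kk {t : K} (ht : t ∈ d.kk) (h0 : t ≠ 0) : d.val t = 0 := by
  rw [d.val_of_ne h0, d.htriv t ht h0, WithTop.coe_zero]

theorem exists_param {n : K} (hn : n ∈ d.R) (h : 0 < d.val n) :
    ∃ r₁ ∈ d.R, ∃ r₂ ∈ d.R, ∃ r₃ ∈ d.R, n = r₁ * d.x + r₂ * d.y + r₃ * d.z := by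
  by_cases h0 : n = 0
  · exact ⟨0, zero_mem _, 0, zero_mem _, 0, zero_mem _, by simp [h0]⟩
  · rw [d.val_of_ne h0] at h
    have hmem := d.hparam n hn h0 (by exact_mod_cast h)
    obtain ⟨r₁, r₂, r₃, hr⟩ := Submodule.mem_span_triple.1 hmem
    refine ⟨r₁, r₁.2, r₂, r₂.2, r₃, r₃.2, ?_⟩
    simpa using (congrArg Subtype.val hr).symm

theorem mono_mul_mem_monoIdealPlus {τ : ℝ} {b e : ℕ →₀ ℕ} (h : d.Admissible b e)
    (hpos : 0 < d.weight b e) {f : K} (hf : f ∈ d.monoIdeal τ) :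
    d.mono b e * f ∈ d.monoIdealPlus τ := by
  induction hf using Submodule.span_induction with
  | mem f hf =>
    obtain ⟨a, c, h', hτ, rfl⟩ := hf
    rw [← d.mono_add]
    exact d.mono_mem_monoIdealPlus (h.add h') (by rw [d.weight_add]; linarith)
  | zero => simp
  | add f g _ _ hf hg =>
    rw [mul_add]
    exact add_mem hf hg
  | smul r f _ hf =>
    rw [mul_smul_comm]
    exact Submodule.smul_mem _ r hf

theorem one_le_len : ((1 : ℕ) : ℕ∞) ≤ d.len := le_trans (by norm_num) d.hlen

/-- Multiplication by an element of positive value strictly raises weights. -/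
theorem mul_mem_of_val_pos {τ : ℝ} {n f : K} (hn : n ∈ d.R) (hpos : 0 < d.val n)
    (hf : f ∈ d.monoIdeal τ) : n * f ∈ d.monoIdealPlus τ := by
  obtain ⟨r₁, h₁, r₂, h₂, r₃, h₃, rfl⟩ := d.exists_param hn hpos
  have hT1 : d.T 1 ≠ 0 := d.hT1 ▸ d.hzne
  have hx := d.mono_mul_mem_monoIdealPlus (d.admissible_single_P le_rfl d.one_le_len 1)
    (by rw [d.weight_single_P, d.hβ 1 le_rfl d.one_le_len, d.hP1]; simpa using d.hνx) hf
  have hy := d.mono_mul_mem_monoIdealPlus (d.admissible_single_P one_le_two d.hlen 1)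
    (by
      rw [d.weight_single_P, d.hβ 2 one_le_two d.hlen, d.hP2]
      simpa using d.hνx.trans_le d.hνxy) hf
  have hz := d.mono_mul_mem_monoIdealPlus (d.admissible_single_T le_rfl hT1 1)
    (by
      rw [d.weight_single_T, (d.hγ 1 le_rfl).2 hT1, d.hT1]
      simpa using d.hνx.trans_le (d.hνxy.trans d.hνyz)) hf
  rw [d.mono_single_P, pow_one, d.hP1] at hx
  rw [d.mono_single_P, pow_one, d.hP2] at hy
  rw [d.mono_single_T, pow_one, d.hT1] at hz
  have := add_mem (add_mem (d.mul_mem_of_mem_R h₁ hx) (d.mul_mem_of_mem_R h₂ hy))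
    (d.mul_mem_of_mem_R h₃ hz)
  convert this using 1
  ring

theorem exists_sub_mem_monoIdealPlus {τ : ℝ} {a₀ c₀ : ℕ →₀ ℕ} (h₀ : d.Admissible a₀ c₀)
    (hI₀ : Irr d.TF (a₀, c₀)) (hw₀ : d.weight a₀ c₀ = τ) {f : K} (hf : f ∈ d.monoIdeal τ) :
    ∃ t ∈ d.kk, f - t * d.mono a₀ c₀ ∈ d.monoIdealPlus τ := by
  have hM : d.mono a₀ c₀ ∈ d.monoIdeal τ := Submodule.subset_span ⟨a₀, c₀, h₀, hw₀.ge, rfl⟩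
  induction hf using Submodule.span_induction with
  | mem f hf =>
    obtain ⟨a, c, h, hτ, rfl⟩ := hf
    rcases hτ.lt_or_eq with hlt | heq
    · exact ⟨0, zero_mem _, by simpa using d.mono_mem_monoIdealPlus h hlt⟩
    · obtain ⟨a', c', u, hr, hI⟩ := d.exists_rule_irr h
      obtain ⟨rfl, rfl⟩ := d.eq_of_irr_of_weight_eq hr.1 h₀ hI hI₀
        (by rw [hr.2.1, hw₀, heq])
      exact ⟨u, hr.2.2.1, heq ▸ hr.2.2.2⟩
  | zero => exact ⟨0, zero_mem _, by simp⟩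
  | add f g _ _ hf hg =>
    obtain ⟨t, ht, hft⟩ := hf
    obtain ⟨u, hu, hgu⟩ := hg
    refine ⟨t + u, add_mem ht hu, ?_⟩
    convert add_mem hft hgu using 1
    ring
  | smul r f _ hf =>
    obtain ⟨t, ht, hft⟩ := hf
    obtain ⟨u, hu, hru⟩ := d.exists_residue (mul_mem r.2 (d.hkR ht))
    refine ⟨u, hu, ?_⟩
    have h1 := d.mul_mem_of_val_pos (sub_mem (mul_mem r.2 (d.hkR ht)) (d.hkR hu)) hru hM
    convert add_mem (Submodule.smul_mem _ r hft) h1 using 1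
    rw [Subring.smul_def, Subring.smul_def, smul_eq_mul, smul_eq_mul]
    ring

theorem mem_monoIdealPlus_of_lt_val {τ : ℝ} {f : K} (hf : f ∈ d.monoIdeal τ)
    (hval : (τ : WithTop ℝ) < d.val f) : f ∈ d.monoIdealPlus τ := by
  by_cases h : ∃ a₀ c₀, d.Admissible a₀ c₀ ∧ Irr d.TF (a₀, c₀) ∧ d.weight a₀ c₀ = τ
  · obtain ⟨a₀, c₀, h₀, hI₀, hw₀⟩ := h
    obtain ⟨t, ht, hft⟩ := d.exists_sub_mem_monoIdealPlus h₀ hI₀ hw₀ hf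
    by_cases h0 : t = 0
    · simpa [h0] using hft
    · have hlt : (τ : WithTop ℝ) < d.val (t * d.mono a₀ c₀) := by
        have : t * d.mono a₀ c₀ = f + -(f - t * d.mono a₀ c₀) := by ring
        rw [this]
        refine AddValuation.map_lt_add _ hval ?_
        rw [AddValuation.map_neg]
        exact d.lt_val_of_mem_monoIdealPlus hft
      rw [AddValuation.map_mul, d.val_of_mem_kk ht h0, zero_add, d.val_mono h₀, hw₀] at hlt
      exact absurd hlt (lt_irrefl _)
  · refine Submodule.span_le.2 ?_ hf
    rintro _ ⟨a, c, hac, hτ, rfl⟩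
    refine d.mono_mem_monoIdealPlus hac (lt_of_le_of_ne hτ fun heq => h ?_)
    obtain ⟨a', c', u, hr, hI⟩ := d.exists_rule_irr hac
    exact ⟨a', c', hr.1, hI, hr.2.1.trans heq.symm⟩

/-- The maximal ideal of `R`, given by its regular parameters. -/
noncomputable def paramIdeal : Ideal d.R := Ideal.span {⟨d.x, d.hx⟩, ⟨d.y, d.hy⟩, ⟨d.z, d.hz⟩}

theorem mem_paramIdeal {n : d.R} (h : 0 < d.val n) : n ∈ d.paramIdeal := by
  by_cases h0 : (n : K) = 0
  · have : n = 0 := Subtype.ext h0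
    rw [this]
    exact zero_mem _
  · rw [d.val_of_ne h0] at h
    exact d.hparam n n.2 h0 (by exact_mod_cast h)

theorem le_val_of_mem_paramIdeal_pow (n : ℕ) {h : d.R} (hh : h ∈ d.paramIdeal ^ n) :
    ((n * d.ν d.x : ℝ) : WithTop ℝ) ≤ d.val h := by
  induction n generalizing h with
  | zero => simpa using d.val_nonneg h.2
  | succ n ih =>
    rw [pow_succ] at hh
    induction hh using Submodule.mul_induction_on' with
    | mem_mul_mem f hf g hg =>
      have hgx : ((d.ν d.x : ℝ) : WithTop ℝ) ≤ d.val g := by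
        obtain ⟨r₁, r₂, r₃, rfl⟩ := Submodule.mem_span_triple.1 hg
        have key : ∀ (r : d.R) (w : K), w ≠ 0 → d.ν d.x ≤ d.ν w →
            ((d.ν d.x : ℝ) : WithTop ℝ) ≤ d.val (r * w) := by
          intro r w hw hle
          rw [AddValuation.map_mul, d.val_of_ne hw]
          exact (WithTop.coe_le_coe.2 hle).trans (le_add_of_nonneg_left (d.val_nonneg r.2))
        simp only [smul_eq_mul, Subring.coe_add, Subring.coe_mul]
        exact AddValuation.map_le_add _
          (AddValuation.map_le_add _ (key _ _ d.hxne le_rfl) (key _ _ d.hyne d.hνxy))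
          (key _ _ d.hzne (d.hνxy.trans d.hνyz))
      have hsum : (((n + 1 : ℕ) : ℝ) * d.ν d.x : ℝ) = n * d.ν d.x + d.ν d.x := by
        push_cast
        ring
      rw [hsum, WithTop.coe_add, Subring.coe_mul, AddValuation.map_mul]
      exact add_le_add (ih hf) hgx
    | add f _ g _ hf hg =>
      rw [Subring.coe_add]
      exact AddValuation.map_le_add _ hf hg

/-- `R` is the sum of a finite-dimensional space over the coefficient field and a given power of
its maximal ideal. -/
theorem exists_finite_span (n : ℕ) : ∃ B : Set K, B.Finite ∧ ∀ f : d.R,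
    ∃ e ∈ Submodule.span d.kk B, ∃ h ∈ d.paramIdeal ^ n, (f : K) = e + h := by
  induction n with
  | zero => exact ⟨∅, Set.finite_empty, fun f => ⟨0, zero_mem _, f, by simp, by simp⟩⟩
  | succ n ih =>
    obtain ⟨B, hB, hBf⟩ := ih
    have hfg : (d.paramIdeal ^ n).FG :=
      Ideal.FG.pow (Submodule.fg_span (by simp))
    obtain ⟨S, hS⟩ := hfg
    refine ⟨B ∪ Subtype.val '' (S : Set d.R), hB.union (S.finite_toSet.image _), fun f => ?_⟩
    obtain ⟨e, he, h, hh, hf⟩ := hBf f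
    have key : ∀ h ∈ d.paramIdeal ^ n, ∃ e ∈ Submodule.span d.kk (Subtype.val '' (S : Set d.R)),
        ∃ h' ∈ d.paramIdeal ^ (n + 1), (h : K) = e + h' := by
      intro h hh
      rw [← hS] at hh
      induction hh using Submodule.span_induction with
      | mem h hh => exact ⟨h, Submodule.subset_span ⟨h, hh, rfl⟩, 0, zero_mem _, by simp⟩
      | zero => exact ⟨0, zero_mem _, 0, zero_mem _, by simp⟩
      | add f g _ _ hf hg =>
        obtain ⟨e₁, he₁, h₁, hh₁, hf⟩ := hf
        obtain ⟨e₂, he₂, h₂, hh₂, hg⟩ := hg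
        refine ⟨e₁ + e₂, add_mem he₁ he₂, h₁ + h₂, add_mem hh₁ hh₂, ?_⟩
        rw [Subring.coe_add, Subring.coe_add, hf, hg]
        ring
      | smul r h hh ih =>
        obtain ⟨e, he, h', hh', heq⟩ := ih
        obtain ⟨t, ht, hrt⟩ := d.exists_residue r.2
        have hh₀ : h ∈ d.paramIdeal ^ n := hS ▸ hh
        have hmul : h * (r - ⟨t, d.hkR ht⟩) ∈ d.paramIdeal ^ (n + 1) := by
          rw [pow_succ]
          exact Ideal.mul_mem_mul hh₀ (d.mem_paramIdeal hrt)
        refine ⟨t * e, Submodule.smul_mem _ (⟨t, ht⟩ : d.kk) he, ⟨t, d.hkR ht⟩ * h' +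
          h * (r - ⟨t, d.hkR ht⟩), add_mem (Ideal.mul_mem_left _ _ hh') hmul, ?_⟩
        simp only [smul_eq_mul, Subring.coe_add, Subring.coe_mul, AddSubgroupClass.coe_sub]
        rw [heq]
        ring
    obtain ⟨e', he', h', hh', heq⟩ := key h hh
    refine ⟨e + e', add_mem (Submodule.span_mono Set.subset_union_left he)
      (Submodule.span_mono Set.subset_union_right he'), h', hh', ?_⟩
    rw [hf, heq]
    ring

/-- Adjoining one vector to a space over the coefficient field adds at most one value. -/
theorem finite_values_span {B : Set K} (hB : B.Finite) :
    {v : ℝ | ∃ e ∈ Submodule.span d.kk B, d.val e = v}.Finite := by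
  induction B, hB using Set.Finite.induction_on with
  | empty => simp
  | @insert b B _ _ ih =>
    have hsub : Set.Subsingleton ({v : ℝ | ∃ e ∈ Submodule.span d.kk (insert b B), d.val e = v} \
        {v : ℝ | ∃ e ∈ Submodule.span d.kk B, d.val e = v}) := by
      have norm : ∀ v ∈ {v : ℝ | ∃ e ∈ Submodule.span d.kk (insert b B), d.val e = v} \
          {v : ℝ | ∃ e ∈ Submodule.span d.kk B, d.val e = v},
          ∃ e ∈ Submodule.span d.kk B, d.val (b + e) = v := by
        rintro v ⟨⟨e, he, hev⟩, hv⟩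
        obtain ⟨t, e', he', rfl⟩ := Submodule.mem_span_insert.1 he
        have ht : (t : K) ≠ 0 := fun h0 => hv ⟨e', he', by
          rw [← hev, Subfield.smul_def, h0]
          simp⟩
        refine ⟨t⁻¹ • e', Submodule.smul_mem _ _ he', ?_⟩
        have heq : t • b + e' = (t : K) * (b + t⁻¹ • e') := by
          rw [Subfield.smul_def, Subfield.smul_def, smul_eq_mul, smul_eq_mul, mul_add,
            Subfield.coe_inv, mul_inv_cancel_left₀ ht]
        rw [← hev, heq, AddValuation.map_mul, d.val_of_mem_kk t.2 ht, zero_add]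
      have key : ∀ v ∈ {v : ℝ | ∃ e ∈ Submodule.span d.kk (insert b B), d.val e = v} \
          {v : ℝ | ∃ e ∈ Submodule.span d.kk B, d.val e = v},
          ∀ w ∈ {v : ℝ | ∃ e ∈ Submodule.span d.kk (insert b B), d.val e = v} \
          {v : ℝ | ∃ e ∈ Submodule.span d.kk B, d.val e = v}, ¬ v < w := by
        intro v hv w hw hlt
        obtain ⟨e₁, he₁, hv₁⟩ := norm v hv
        obtain ⟨e₂, he₂, hw₂⟩ := norm w hw
        refine hv.2 ⟨e₁ - e₂, sub_mem he₁ he₂, ?_⟩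
        have heq : e₁ - e₂ = (b + e₁) - (b + e₂) := by ring
        rw [heq, ← hv₁]
        refine AddValuation.map_sub_eq_of_lt_left _ ?_
        rw [hv₁, hw₂]
        exact_mod_cast hlt
      intro v hv w hw
      exact le_antisymm (not_lt.1 (key w hw v hv)) (not_lt.1 (key v hv w hw))
    exact (ih.union hsub.finite).subset fun v hv => by
      by_cases h : v ∈ {v : ℝ | ∃ e ∈ Submodule.span d.kk B, d.val e = v}
      · exact Or.inl h
      · exact Or.inr ⟨hv, h⟩

/-- Only finitely many values of elements of `R` lie below a given bound. -/
theorem finite_values_lt (σ : ℝ) : {v : ℝ | v < σ ∧ ∃ f ∈ d.R, d.val f = v}.Finite := by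
  obtain ⟨n, hn⟩ := Archimedean.arch σ d.hνx
  obtain ⟨B, hB, hBf⟩ := d.exists_finite_span n
  refine (d.finite_values_span hB).subset ?_
  rintro v ⟨hv, f, hf, hfv⟩
  obtain ⟨e, he, h, hh, heq⟩ := hBf ⟨f, hf⟩
  refine ⟨e, he, ?_⟩
  have hle := d.le_val_of_mem_paramIdeal_pow n hh
  rw [nsmul_eq_mul] at hn
  have hlt : d.val f < d.val h := by
    rw [hfv]
    exact lt_of_lt_of_le (by exact_mod_cast hv.trans_le hn) hle
  have : e = f - h := by
    rw [eq_sub_iff_add_eq]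
    exact heq.symm
  rw [this, ← hfv]
  exact AddValuation.map_sub_eq_of_lt_left _ hlt

theorem mem_monoIdeal_of_le_val {σ : ℝ} {f : K} (hf : f ∈ d.R) (hσ : (σ : WithTop ℝ) ≤ d.val f) :
    f ∈ d.monoIdeal σ := by
  have key : ∀ (s : Finset ℝ) (τ : ℝ), (∀ v, τ < v → v < σ → (∃ g ∈ d.R, d.val g = v) → v ∈ s) →
      f ∈ d.monoIdeal τ → f ∈ d.monoIdeal σ := by
    intro s
    induction s using Finset.strongInduction with
    | H s ih =>
      intro τ hs hfτ
      have mono_le : ∀ {τ' τ'' : ℝ}, (∀ v, τ' < v → (v < σ → ∃ g ∈ d.R, d.val g = v) → τ'' ≤ v) →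
          d.monoIdealPlus τ' ≤ d.monoIdeal τ'' := by
        intro τ' τ'' h
        refine Submodule.span_le.2 ?_
        rintro _ ⟨a, c, hac, hw, rfl⟩
        exact Submodule.subset_span
          ⟨a, c, hac, h _ hw fun _ => ⟨_, d.mono_mem hac, d.val_mono hac⟩, rfl⟩
      rcases le_or_gt σ τ with hle | hlt
      · refine Submodule.span_mono ?_ hfτ
        rintro _ ⟨a, c, hac, hw, rfl⟩
        exact ⟨a, c, hac, hle.trans hw, rfl⟩
      · have hfp := d.mem_monoIdealPlus_of_lt_val hfτ
          (lt_of_lt_of_le (by exact_mod_cast hlt) hσ)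
        set S := s.filter fun v => τ < v with hS
        by_cases hne : S.Nonempty
        · have hmin := Finset.min'_mem S hne
          set τ' := S.min' hne with hτ'
          rw [hS, Finset.mem_filter] at hmin
          rcases le_or_gt σ τ' with hστ | hστ
          · refine mono_le (fun v hv hvR => ?_) hfp
            by_contra hcon
            have hvσ := not_le.1 hcon
            have : τ' ≤ v := Finset.min'_le _ _
              (by rw [hS, Finset.mem_filter]; exact ⟨hs v hv hvσ (hvR hvσ), hv⟩)
            linarith
          · refine ih (s.erase τ') (Finset.erase_ssubset hmin.1) τ' ?_ (mono_le ?_ hfp)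
            · intro v hv hvσ hvR
              exact Finset.mem_erase.2 ⟨hv.ne', hs v (hmin.2.trans hv) hvσ hvR⟩
            · intro v hv hvR
              rcases le_or_gt σ v with h | h
              · linarith
              · exact Finset.min'_le _ _
                  (by rw [hS, Finset.mem_filter]; exact ⟨hs v hv h (hvR h), hv⟩)
        · refine mono_le (fun v hv hvR => ?_) hfp
          by_contra hcon
          have hvσ := not_le.1 hcon
          exact hne ⟨v, by rw [hS, Finset.mem_filter]; exact ⟨hs v hv hvσ (hvR hvσ), hv⟩⟩
  refine key (d.finite_values_lt σ).toFinset 0 (fun v _ hv hR => by simpa using ⟨hv, hR⟩) ?_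
  have h1 : (1 : K) ∈ d.monoIdeal 0 :=
    Submodule.subset_span ⟨0, 0, ⟨fun l hl => by simp at hl, fun l hl => by simp at hl⟩,
      by simp [weight], by simp [mono]⟩
  simpa using d.mul_mem_of_mem_R hf h1

theorem supp_sup (c : ℕ →₀ ℕ) (h0 : c 0 = 0) : Supp (c.support.sup id) c := by
  rintro l (rfl | hl)
  · exact h0
  · by_contra hne
    have h2 : l ≤ c.support.sup id := Finset.le_sup (f := id) (by simpa using hne)
    omega

/-- The combinations of finite products of nonzero jumping polynomials of value at least `σ`. -/
theorem exists_combination {σ : ℝ} {f : K} (hf : f ∈ d.monoIdeal σ) :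
    ∃ (M : ℕ) (g : Fin M → K) (kb ib : Fin M → ℕ) (A C : Fin M → Vec),
      (∀ e, g e ∈ d.R) ∧ (∀ e, ((kb e : ℕ) : ℕ∞) ≤ d.len) ∧
      (∀ e, Supp (kb e) (A e)) ∧ (∀ e, Supp (ib e) (C e)) ∧
      (∀ e l, C e l ≠ 0 → d.T l ≠ 0) ∧
      (∀ e, σ ≤ (∑ l ∈ Finset.Icc 1 (kb e), (A e l : ℝ) * d.ν (d.P l)) +
                (∑ l ∈ Finset.Icc 1 (ib e), (C e l : ℝ) * d.ν (d.T l))) ∧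
      f = ∑ e, g e * (d.Pm (kb e) (A e) * d.Tm (ib e) (C e)) := by
  obtain ⟨M, g, w, rfl⟩ := Submodule.mem_span_set'.1 hf
  choose a c hac hσ hw using fun e => (w e).2
  choose k hk hka using fun e => d.exists_bound (hac e)
  have hcs := fun e => supp_sup (c e) (hac e).apply_zero.2
  refine ⟨M, fun e => g e, k, fun e => (c e).support.sup id, fun e => a e, fun e => c e,
    fun e => (g e).2, hk, hka, hcs, fun e l hl => ((hac e).2 l hl).2, fun e => ?_, ?_⟩
  · refine (hσ e).trans_eq ?_
    rw [weight, ← wtA_eq_sum _ (hka e), ← wtA_eq_sum _ (hcs e)]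
    congr 1
    · refine Finset.sum_congr rfl fun l hl => ?_
      obtain ⟨h1, h2⟩ := Finset.mem_Icc.1 hl
      rw [d.hβ l h1 (le_trans (by exact_mod_cast h2) (hk e))]
    · refine Finset.sum_congr rfl fun l hl => ?_
      by_cases h0 : c e l = 0
      · simp [h0]
      · rw [(d.hγ l (Finset.mem_Icc.1 hl).1).2 ((hac e).2 l h0).2]
  · refine Finset.sum_congr rfl fun e _ => ?_
    rw [hw e, Subring.smul_def, smul_eq_mul, mono, Pm, Tm, prod_Icc_eq _ (hka e),
      prod_Icc_eq _ (hcs e)]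

theorem Av_subset_Iv (σ : ℝ) : d.Av σ ⊆ d.Iv σ := by
  rintro _ ⟨M, g, k, i, A, C, hg, hk, hA, hC, hw, rfl⟩
  refine ⟨sum_mem fun e _ => mul_mem (hg e) (mul_mem (prod_mem fun l hl => pow_mem ?_ _)
    (prod_mem fun l hl => pow_mem ?_ _)), d.le_val_iff.1 ?_⟩
  · obtain ⟨h1, h2⟩ := Finset.mem_Icc.1 hl
    exact d.hPmem l h1 (le_trans (by exact_mod_cast h2) (hk e))
  · exact d.hTmem l (Finset.mem_Icc.1 hl).1
  · refine AddValuation.map_le_sum _ fun e _ => ?_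
    by_cases h0 : d.Tm (i e) (C e) = 0
    · simp [h0]
    · rw [AddValuation.map_mul, AddValuation.map_mul]
      have hP : d.val (d.Pm (k e) (A e)) = (wtA d.β (k e) (A e) : ℝ) :=
        d.val_prod _ _ _ _ fun l hl _ => by
          obtain ⟨h1, h2⟩ := Finset.mem_Icc.1 hl
          exact d.val_P h1 (le_trans (by exact_mod_cast h2) (hk e))
      have hT : d.val (d.Tm (i e) (C e)) = (wtA d.γ (i e) (C e) : ℝ) :=
        d.val_prod _ _ _ _ fun l hl hCl => by
          refine d.val_T (Finset.mem_Icc.1 hl).1 fun hTl => h0 ?_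
          exact Finset.prod_eq_zero hl (by rw [hTl, zero_pow hCl])
      rw [hP, hT, ← WithTop.coe_add]
      exact (WithTop.coe_le_coe.2 (hw e)).trans
        (le_add_of_nonneg_left (d.val_nonneg (hg e)))

theorem mem_Av_of_combination {σ : ℝ} {f : K}
    (hf : ∃ (M : ℕ) (g : Fin M → K) (kb ib : Fin M → ℕ) (A C : Fin M → Vec),
      (∀ e, g e ∈ d.R) ∧ (∀ e, ((kb e : ℕ) : ℕ∞) ≤ d.len) ∧
      (∀ e, Supp (kb e) (A e)) ∧ (∀ e, Supp (ib e) (C e)) ∧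
      (∀ e l, C e l ≠ 0 → d.T l ≠ 0) ∧
      (∀ e, σ ≤ (∑ l ∈ Finset.Icc 1 (kb e), (A e l : ℝ) * d.ν (d.P l)) +
                (∑ l ∈ Finset.Icc 1 (ib e), (C e l : ℝ) * d.ν (d.T l))) ∧
      f = ∑ e, g e * (d.Pm (kb e) (A e) * d.Tm (ib e) (C e))) : f ∈ d.Av σ := by
  obtain ⟨M, g, k, i, A, C, hg, hk, hA, hC, hT, hw, rfl⟩ := hf
  refine ⟨M, g, k, i, A, C, hg, hk, hA, hC, fun e => (hw e).trans_eq ?_, rfl⟩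
  rw [wt, wtA, wtA]
  congr 1
  · refine Finset.sum_congr rfl fun l hl => ?_
    obtain ⟨h1, h2⟩ := Finset.mem_Icc.1 hl
    rw [d.hβ l h1 (le_trans (by exact_mod_cast h2) (hk e))]
  · refine Finset.sum_congr rfl fun l hl => ?_
    by_cases h0 : C e l = 0
    · simp [h0]
    · rw [(d.hγ l (Finset.mem_Icc.1 hl).1).2 (hT e l h0)]

end Jump.RSetup

namespace Jump

/-- Theorem 5.3. For every `σ` in the value semigroup `S_R = ν(R∖{0})`
one has `I_σ = 𝒜_σ`; consequently, the set `{P_j}_{j>0} ∪ {T_i}_{i>0}` of jumping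
polynomials is a generating sequence of `ν` in `R`: every valuation ideal `I_σ`
(`σ ∈ S_R`) is generated, as an ideal of `R`, by the finite products
`∏ P_j^{a_j} ∏ T_i^{c_i}` whose value `Σ a_jν(P_j) + Σ c_iν(T_i)` is at least `σ`
(and finite, i.e. avoiding the zero members of the `T`-sequence). -/
theorem valuation_ideal_eq_and_generating_sequence {K : Type} [Field K] (d : RSetup K) :
    (∀ σ ∈ d.SR, d.Iv σ = d.Av σ) ∧
    (∀ σ ∈ d.SR, d.Iv σ =
      {f : K | ∃ (M : ℕ) (g : Fin M → K) (kb ib : Fin M → ℕ) (A C : Fin M → Vec),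
        (∀ e, g e ∈ d.R) ∧ (∀ e, ((kb e : ℕ) : ℕ∞) ≤ d.len) ∧
        (∀ e, Supp (kb e) (A e)) ∧ (∀ e, Supp (ib e) (C e)) ∧
        (∀ e l, C e l ≠ 0 → d.T l ≠ 0) ∧
        (∀ e, σ ≤ (∑ l ∈ Finset.Icc 1 (kb e), (A e l : ℝ) * d.ν (d.P l)) +
                  (∑ l ∈ Finset.Icc 1 (ib e), (C e l : ℝ) * d.ν (d.T l))) ∧
        f = ∑ e, g e * (d.Pm (kb e) (A e) * d.Tm (ib e) (C e))}) := by
  have hIv : ∀ {σ : ℝ} {f : K}, f ∈ d.Iv σ → f ∈ d.monoIdeal σ := fun hf =>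
    d.mem_monoIdeal_of_le_val hf.1 (d.le_val_iff.2 hf.2)
  refine ⟨fun σ _ => ?_, fun σ _ => ?_⟩
  · exact Set.Subset.antisymm
      (fun f hf => d.mem_Av_of_combination (d.exists_combination (hIv hf))) (d.Av_subset_Iv σ)
  · exact Set.Subset.antisymm (fun f hf => d.exists_combination (hIv hf))
      fun f hf => d.Av_subset_Iv σ (d.mem_Av_of_combination hf)

end Jump
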